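/- Let U be a nonnegative solution of the extension problem on the punctured half-ball 𝔅_2^+, with trace u(x) = U(x,0), and suppose there exist positive constants c₁, c₂ such that c₁|x|^{−(n−2σ)/2} ≤ u(x) ≤ c₂|x|^{−(n−2σ)/2} for all x with 0 < |x| < 1. Then there exist positive constants C₁ and C₂ such that C₁|X|^{−(n−2σ)/2} ≤ U(X) ≤ C₂|X|^{−(n−2σ)/2} for all X = (x,t) with t ≥ 0 and 0 < |X| ≤ 1/2. -/

import Mathlib

open scoped Topology MeasureTheory RealInnerProductSpace
open Filter MeasureTheory

noncomputable section

/-- Points of `ℝ^{n+1}`, written `X = (x, t)` with `x ∈ ℝⁿ` and `t ∈ ℝ`. -/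
abbrev Pt (n : ℕ) := EuclideanSpace ℝ (Fin n) × ℝ

/-- The Euclidean norm on `ℝ^{n+1} = ℝⁿ × ℝ`. -/
def enorm' {n : ℕ} (X : Pt n) : ℝ := Real.sqrt (‖X.1‖ ^ 2 + X.2 ^ 2)

/-- Partial derivative in the last (`t`) direction. -/
def dt {n : ℕ} (U : Pt n → ℝ) (X : Pt n) : ℝ := fderiv ℝ U X (0, 1)

/-- Second derivative in the direction `v`. -/
def d2 {n : ℕ} (U : Pt n → ℝ) (X v : Pt n) : ℝ :=
  fderiv ℝ (fun Y => fderiv ℝ U Y v) X v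

/-- The Laplacian on `ℝ^{n+1}`. -/
def lapl {n : ℕ} (U : Pt n → ℝ) (X : Pt n) : ℝ :=
  (∑ i : Fin n, d2 U X (EuclideanSpace.single i (1 : ℝ), (0 : ℝ))) + d2 U X (0, 1)

/-- `U` is a nonnegative solution of the extension problem on the punctured half-ball
`𝔅_R^+`: it is nonnegative and continuous on `{|X| ≤ R, t ≥ 0} \ {0}`, `C²` on `𝔅_R^+`,
satisfies `ΔU + ((1-2σ)/t) ∂_t U = 0` there, and satisfies the nonlinear Neumann condition
`lim_{t→0⁺} t^{1-2σ} ∂_t U(x,t) = -u(x)^{(n+2σ)/(n-2σ)}` for `x ∈ B_R \ {0}`. -/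
def ExtSol (n : ℕ) (σ R : ℝ) (U : Pt n → ℝ) : Prop :=
  (∀ X : Pt n, enorm' X ≤ R → 0 ≤ X.2 → X ≠ 0 → 0 ≤ U X) ∧
  ContinuousOn U ({X : Pt n | enorm' X ≤ R ∧ 0 ≤ X.2} \ {0}) ∧
  ContDiffOn ℝ 2 U {X : Pt n | enorm' X < R ∧ 0 < X.2} ∧
  (∀ X : Pt n, enorm' X < R → 0 < X.2 →
    lapl U X + ((1 - 2 * σ) / X.2) * dt U X = 0) ∧
  (∀ x : EuclideanSpace ℝ (Fin n), ‖x‖ < R → x ≠ 0 →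
    Tendsto (fun t : ℝ => t ^ (1 - 2 * σ) * dt U (x, t)) (𝓝[>] 0)
      (𝓝 (-(U (x, 0) ^ (((n : ℝ) + 2 * σ) / ((n : ℝ) - 2 * σ))))))

/-- The squared Euclidean norm on `ℝⁿ × ℝ`. -/
def sqn {n : ℕ} (X : Pt n) : ℝ := ‖X.1‖ ^ 2 + X.2 ^ 2

/-- `f` is twice differentiable at `X` along the line in direction `v`, with first and second
derivatives `d` and `c`. -/
def LineJet {n : ℕ} (f : Pt n → ℝ) (X v : Pt n) (d c : ℝ) : Prop :=
  ∃ g : ℝ → ℝ, (∀ᶠ s in 𝓝 (0 : ℝ), HasDerivAt (fun s : ℝ => f (X + s • v)) (g s) s) ∧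
    g 0 = d ∧ HasDerivAt g c 0

namespace LineJet

variable {n : ℕ} {f g : Pt n → ℝ} {X v : Pt n} {d c d' c' : ℝ}

lemma add (hf : LineJet f X v d c) (hg : LineJet g X v d' c') :
    LineJet (fun Y => f Y + g Y) X v (d + d') (c + c') := by
  obtain ⟨F, hF, hF0, hF'⟩ := hf
  obtain ⟨G, hG, hG0, hG'⟩ := hg
  refine ⟨fun s => F s + G s, ?_, by simp [hF0, hG0], hF'.add hG'⟩
  filter_upwards [hF, hG] with s h1 h2 using h1.add h2

lemma const_mul (a : ℝ) (hf : LineJet f X v d c) :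
    LineJet (fun Y => a * f Y) X v (a * d) (a * c) := by
  obtain ⟨F, hF, hF0, hF'⟩ := hf
  refine ⟨fun s => a * F s, ?_, by simp [hF0], hF'.const_mul a⟩
  filter_upwards [hF] with s h1 using h1.const_mul a

lemma const (a : ℝ) : LineJet (fun _ => a) X v 0 0 :=
  ⟨fun _ => 0, Eventually.of_forall fun _ => hasDerivAt_const _ _, rfl, hasDerivAt_const _ _⟩

lemma comp (hf : LineJet f X v d c) {G G' : ℝ → ℝ} {G'' : ℝ}
    (hG : ∀ᶠ y in 𝓝 (f X), HasDerivAt G (G' y) y) (hG' : HasDerivAt G' G'' (f X)) :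
    LineJet (fun Y => G (f Y)) X v (G' (f X) * d) (G'' * d ^ 2 + G' (f X) * c) := by
  obtain ⟨F, hF, hF0, hF'⟩ := hf
  have h0 : HasDerivAt (fun s : ℝ => f (X + s • v)) d 0 := hF0 ▸ hF.self_of_nhds
  have hX : f (X + (0 : ℝ) • v) = f X := by simp
  refine ⟨fun s => G' (f (X + s • v)) * F s, ?_, by simp [hF0], ?_⟩
  · have hc : Tendsto (fun s : ℝ => f (X + s • v)) (𝓝 0) (𝓝 (f X)) := by
      simpa [hX] using h0.continuousAt.tendsto
    filter_upwards [hF, hc.eventually hG] with s h1 h2 using h2.comp s h1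
  · have h1 : HasDerivAt (fun s : ℝ => G' (f (X + s • v))) (G'' * d) 0 :=
      HasDerivAt.comp (0 : ℝ) (h₂ := G') (by rw [hX]; exact hG') h0
    convert! h1.mul hF' using 1
    rw [hX, hF0]; ring

/-- The necessary second-order condition at a minimum. -/
lemma of_isLocalMin (hf : LineJet f X v d c) (hmin : IsLocalMin f X) : d = 0 ∧ 0 ≤ c := by
  obtain ⟨F, hF, hF0, hF'⟩ := hf
  have hline : Tendsto (fun s : ℝ => X + s • v) (𝓝 0) (𝓝 X) := by
    have : Continuous (fun s : ℝ => X + s • v) := by fun_prop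
    simpa using this.tendsto 0
  have hm : ∀ᶠ s : ℝ in 𝓝 0, f X ≤ f (X + s • v) := hline.eventually hmin
  have hd : d = 0 := by
    have : IsLocalMin (fun s : ℝ => f (X + s • v)) 0 := by
      filter_upwards [hm] with s hs
      simpa using hs
    rw [← hF0]
    exact this.hasDerivAt_eq_zero hF.self_of_nhds
  refine ⟨hd, ?_⟩
  by_contra! hc
  have hF00 : F 0 = 0 := hF0.trans hd
  have hneg : ∀ᶠ s in 𝓝[>] (0 : ℝ), F s < 0 := by
    have := hF'.tendsto_slope_zero_right
    filter_upwards [this.eventually_lt_const hc, self_mem_nhdsWithin] with s hs hs0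
    simp only [zero_add, hF00, sub_zero, smul_eq_mul, Set.mem_Ioi] at hs hs0
    by_contra! h
    have : 0 ≤ s⁻¹ * F s := by positivity
    linarith
  obtain ⟨δ, hδ, hall⟩ := mem_nhdsGT_iff_exists_Ioo_subset.1
    (inter_mem hneg (inter_mem (nhdsWithin_le_nhds hF) (nhdsWithin_le_nhds hm)))
  have hδ' : (0 : ℝ) < δ := hδ
  have hanti : StrictAntiOn (fun s : ℝ => f (X + s • v)) (Set.Icc 0 (δ / 2)) := by
    apply strictAntiOn_of_hasDerivWithinAt_neg (convex_Icc _ _) (f' := F)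
    · intro s hs
      rcases hs.1.eq_or_lt with h | h
      · subst h
        exact hF.self_of_nhds.continuousAt.continuousWithinAt
      · exact (hall ⟨h, by linarith [hs.2]⟩).2.1.continuousAt.continuousWithinAt
    · intro s hs
      rw [interior_Icc] at hs
      exact (hall ⟨hs.1, by linarith [hs.2]⟩).2.1.hasDerivWithinAt
    · intro s hs
      rw [interior_Icc] at hs
      exact (hall ⟨hs.1, by linarith [hs.2]⟩).1
  have h1 := hanti (a := 0) ⟨le_rfl, by linarith⟩ (b := δ / 2) ⟨by linarith, le_rfl⟩ (by linarith)
  have h2 := (hall (a := δ / 2) ⟨by linarith, by linarith⟩).2.2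
  simp only [zero_smul, add_zero, Set.mem_ofPred_eq] at h1 h2
  linarith

end LineJet

/-- `f` is twice differentiable at `X` along the coordinate directions, and the extension operator
`Δ + ((1-2σ)/t) ∂_t` applied to `f` at `X` equals `l`. -/
def HasL {n : ℕ} (σ : ℝ) (f : Pt n → ℝ) (X : Pt n) (l : ℝ) : Prop :=
  ∃ (p h : Fin n → ℝ) (b c : ℝ),
    (∀ i, LineJet f X (EuclideanSpace.single i (1 : ℝ), (0 : ℝ)) (p i) (h i)) ∧
    LineJet f X (0, 1) b c ∧ (∑ i, h i) + c + (1 - 2 * σ) / X.2 * b = l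

namespace HasL

variable {n : ℕ} {σ : ℝ} {f g : Pt n → ℝ} {X : Pt n} {l l' : ℝ}

lemma add (hf : HasL σ f X l) (hg : HasL σ g X l') : HasL σ (fun Y => f Y + g Y) X (l + l') := by
  obtain ⟨p, h, b, c, h1, h2, h3⟩ := hf
  obtain ⟨p', h', b', c', h1', h2', h3'⟩ := hg
  refine ⟨_, _, _, _, fun i => (h1 i).add (h1' i), h2.add h2', ?_⟩
  rw [Finset.sum_add_distrib, ← h3, ← h3']; ring

lemma const_mul (a : ℝ) (hf : HasL σ f X l) : HasL σ (fun Y => a * f Y) X (a * l) := by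
  obtain ⟨p, h, b, c, h1, h2, h3⟩ := hf
  refine ⟨_, _, _, _, fun i => (h1 i).const_mul a, h2.const_mul a, ?_⟩
  rw [← Finset.mul_sum, ← h3]; ring

lemma const (a : ℝ) : HasL σ (fun _ => a) X 0 :=
  ⟨_, _, _, _, fun _ => LineJet.const a, LineJet.const a, by simp⟩

lemma nonneg_of_isLocalMin (hf : HasL σ f X l) (hmin : IsLocalMin f X) : 0 ≤ l := by
  obtain ⟨p, h, b, c, h1, h2, h3⟩ := hf
  obtain ⟨hb, hc⟩ := h2.of_isLocalMin hmin
  have := Finset.sum_nonneg fun i (_ : i ∈ Finset.univ) => ((h1 i).of_isLocalMin hmin).2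
  rw [← h3, hb]; linarith

end HasL

/-- The weighted normal derivative `lim_{t → 0⁺} t^{1-2σ} ∂_t f(x,t)` exists and equals `l`. -/
def HasFlux {n : ℕ} (σ : ℝ) (f : Pt n → ℝ) (x : EuclideanSpace ℝ (Fin n)) (l : ℝ) : Prop :=
  ∃ w : ℝ → ℝ, (∀ᶠ s in 𝓝[>] (0 : ℝ), HasDerivAt (fun τ => f (x, τ)) (w s) s) ∧
    Tendsto (fun s : ℝ => s ^ (1 - 2 * σ) * w s) (𝓝[>] 0) (𝓝 l)

namespace HasFlux

variable {n : ℕ} {σ : ℝ} {f g : Pt n → ℝ} {x : EuclideanSpace ℝ (Fin n)} {l l' : ℝ}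

lemma add (hf : HasFlux σ f x l) (hg : HasFlux σ g x l') :
    HasFlux σ (fun Y => f Y + g Y) x (l + l') := by
  obtain ⟨w, h1, h2⟩ := hf
  obtain ⟨w', h1', h2'⟩ := hg
  refine ⟨fun s => w s + w' s, ?_, ?_⟩
  · filter_upwards [h1, h1'] with s h h' using h.add h'
  · simpa only [mul_add] using h2.add h2'

lemma const_mul (a : ℝ) (hf : HasFlux σ f x l) : HasFlux σ (fun Y => a * f Y) x (a * l) := by
  obtain ⟨w, h1, h2⟩ := hf
  refine ⟨fun s => a * w s, ?_, ?_⟩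
  · filter_upwards [h1] with s h using h.const_mul a
  · simpa only [mul_left_comm] using h2.const_mul a

/-- A function whose vertical derivative is `t` times a bounded factor has zero flux. -/
lemma zero_of_even (hσ : σ < 1) {k : ℝ → ℝ} {k₀ : ℝ}
    (h : ∀ᶠ s in 𝓝[>] (0 : ℝ), HasDerivAt (fun τ => f (x, τ)) (s * k s) s)
    (hk : Tendsto k (𝓝[>] 0) (𝓝 k₀)) : HasFlux σ f x 0 := by
  refine ⟨_, h, ?_⟩
  have h1 : Tendsto (fun s : ℝ => s ^ (2 - 2 * σ)) (𝓝[>] 0) (𝓝 0) := by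
    have := (Real.continuousAt_rpow_const (0 : ℝ) (2 - 2 * σ) (Or.inr (by linarith))).tendsto
    rw [Real.zero_rpow (by linarith)] at this
    exact this.mono_left nhdsWithin_le_nhds
  have h2 := h1.mul hk
  rw [zero_mul] at h2
  refine h2.congr' ?_
  filter_upwards [self_mem_nhdsWithin] with s hs
  have hs : (0 : ℝ) < s := hs
  rw [show (2 - 2 * σ) = (1 - 2 * σ) + 1 by ring, Real.rpow_add_one hs.ne']
  ring

/-- The Hopf-type condition: a negative flux is impossible at a boundary minimum. -/
lemma exists_lt {K : Set (Pt n)} (hf : HasFlux σ f x l) (hl : l < 0)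
    (hc : ContinuousOn f K) (h0 : (x, (0 : ℝ)) ∈ K) (hK : ∀ᶠ s in 𝓝[>] (0 : ℝ), (x, s) ∈ K) :
    ∃ Y ∈ K, f Y < f (x, 0) := by
  obtain ⟨w, h1, h2⟩ := hf
  obtain ⟨δ, hδ, hall⟩ := mem_nhdsGT_iff_exists_Ioo_subset.1
    (inter_mem (h2.eventually_lt_const hl) (inter_mem h1 hK))
  have hδ' : (0 : ℝ) < δ := hδ
  have hmem : ∀ s ∈ Set.Icc 0 (δ / 2), (x, s) ∈ K := by
    intro s hs
    rcases hs.1.eq_or_lt with h | h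
    · exact h ▸ h0
    · exact (hall ⟨h, by linarith [hs.2]⟩).2.2
  have hanti : StrictAntiOn (fun s : ℝ => f (x, s)) (Set.Icc 0 (δ / 2)) := by
    apply strictAntiOn_of_hasDerivWithinAt_neg (convex_Icc _ _) (f' := w)
    · exact hc.comp (by fun_prop) hmem
    · intro s hs
      rw [interior_Icc] at hs
      exact (hall ⟨hs.1, by linarith [hs.2]⟩).2.1.hasDerivWithinAt
    · intro s hs
      rw [interior_Icc] at hs
      have h : s ^ (1 - 2 * σ) * w s < 0 := (hall ⟨hs.1, by linarith [hs.2]⟩).1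
      have h' : 0 < s ^ (1 - 2 * σ) := Real.rpow_pos_of_pos hs.1 _
      by_contra! hw
      have := mul_nonneg h'.le hw
      linarith
  exact ⟨_, hmem (δ / 2) ⟨by linarith, le_rfl⟩,
    hanti (a := 0) ⟨le_rfl, by linarith⟩ (b := δ / 2) ⟨by linarith, le_rfl⟩ (by linarith)⟩

end HasFlux

/-- The maximum principle: a function on a compact set is nonnegative provided that, wherever it is
negative, it is a strict supersolution in the interior or has negative flux on `{t = 0}`. -/
theorem nonneg_of_strict_supersolution {n : ℕ} {σ : ℝ} {K : Set (Pt n)} (hK : IsCompact K)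
    {W : Pt n → ℝ} (hW : ContinuousOn W K)
    (h : ∀ X ∈ K, W X < 0 →
      (K ∈ 𝓝 X ∧ ∃ l < 0, HasL σ W X l) ∨
      (X.2 = 0 ∧ (∀ᶠ s in 𝓝[>] (0 : ℝ), (X.1, s) ∈ K) ∧ ∃ l < 0, HasFlux σ W X.1 l)) :
    ∀ X ∈ K, 0 ≤ W X := by
  intro X hX
  obtain ⟨Y, hY, hmin⟩ := hK.exists_isMinOn ⟨X, hX⟩ hW
  refine le_trans ?_ (hmin hX)
  by_contra! hneg
  rcases h Y hY hneg with ⟨hn, l, hl, hL⟩ | ⟨h0, hs, l, hl, hF⟩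
  · exact absurd (hL.nonneg_of_isLocalMin (hmin.isLocalMin hn)) (not_le.2 hl)
  · have hY' : Y = (Y.1, (0 : ℝ)) := Prod.ext rfl h0
    obtain ⟨Z, hZ, hlt⟩ := hF.exists_lt hl hW (hY' ▸ hY) hs
    rw [← hY'] at hlt
    exact absurd (hmin hZ) (not_le.2 hlt)

section TestFunctions

variable {n : ℕ}

lemma lineJet_normSq_horizontal (x₀ : EuclideanSpace ℝ (Fin n)) (X : Pt n) (i : Fin n) :
    LineJet (fun Y : Pt n => ‖Y.1 - x₀‖ ^ 2) X (EuclideanSpace.single i (1 : ℝ), (0 : ℝ))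
      (2 * (X.1 - x₀) i) 2 := by
  refine ⟨fun s => 2 * (X.1 - x₀) i + 2 * s, Eventually.of_forall fun s => ?_, by simp, ?_⟩
  · have : (fun s : ℝ => ‖(X + s • ((EuclideanSpace.single i (1 : ℝ), (0 : ℝ)) : Pt n)).1 - x₀‖ ^ 2)
        = fun s => ‖X.1 - x₀‖ ^ 2 + 2 * (X.1 - x₀) i * s + s ^ 2 := by
      funext s
      rw [Prod.fst_add, Prod.smul_fst, add_sub_right_comm, norm_add_sq_real, inner_smul_right,
        EuclideanSpace.inner_single_right, norm_smul, PiLp.norm_single]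
      simp
      ring
    rw [this]
    have h := ((((hasDerivAt_id s).const_mul (2 * (X.1 - x₀) i)).const_add
      (‖X.1 - x₀‖ ^ 2)).add ((hasDerivAt_id s).pow 2))
    convert! h using 1
    simp
  · have h := ((hasDerivAt_id (0 : ℝ)).const_mul 2).const_add (2 * (X.1 - x₀) i)
    convert! h using 1
    simp

lemma lineJet_normSq_vertical (x₀ : EuclideanSpace ℝ (Fin n)) (X : Pt n) :
    LineJet (fun Y : Pt n => ‖Y.1 - x₀‖ ^ 2) X (0, 1) 0 0 := by
  refine ⟨fun _ => 0, Eventually.of_forall fun s => ?_, rfl, hasDerivAt_const _ _⟩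
  simpa using hasDerivAt_const s (‖X.1 - x₀‖ ^ 2)

lemma lineJet_snd_horizontal (X : Pt n) (x : EuclideanSpace ℝ (Fin n)) :
    LineJet (fun Y : Pt n => Y.2) X (x, 0) 0 0 := by
  refine ⟨fun _ => 0, Eventually.of_forall fun s => ?_, rfl, hasDerivAt_const _ _⟩
  simpa using hasDerivAt_const s X.2

lemma lineJet_snd_vertical (X : Pt n) : LineJet (fun Y : Pt n => Y.2) X (0, 1) 1 0 := by
  refine ⟨fun _ => 1, Eventually.of_forall fun s => ?_, rfl, hasDerivAt_const _ _⟩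
  simpa using (hasDerivAt_id s).const_add X.2

/-- The extension operator applied to `G (A |x - x₀|² + h(t))`. -/
lemma hasL_comp {σ : ℝ} (x₀ : EuclideanSpace ℝ (Fin n)) (A : ℝ) {h h' G G' : ℝ → ℝ} {h'' G'' : ℝ}
    {X : Pt n} (hh : ∀ᶠ t in 𝓝 X.2, HasDerivAt h (h' t) t) (hh' : HasDerivAt h' h'' X.2)
    (hG : ∀ᶠ y in 𝓝 (A * ‖X.1 - x₀‖ ^ 2 + h X.2), HasDerivAt G (G' y) y)
    (hG' : HasDerivAt G' G'' (A * ‖X.1 - x₀‖ ^ 2 + h X.2)) :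
    HasL σ (fun Y => G (A * ‖Y.1 - x₀‖ ^ 2 + h Y.2)) X
      (G'' * (4 * A ^ 2 * ‖X.1 - x₀‖ ^ 2 + h' X.2 ^ 2) +
        G' (A * ‖X.1 - x₀‖ ^ 2 + h X.2) *
          (2 * n * A + h'' + (1 - 2 * σ) / X.2 * h' X.2)) := by
  refine ⟨_, _, _, _, fun i => (((lineJet_normSq_horizontal x₀ X i).const_mul A).add
    ((lineJet_snd_horizontal X _).comp hh hh')).comp hG hG',
    (((lineJet_normSq_vertical x₀ X).const_mul A).add
    ((lineJet_snd_vertical X).comp hh hh')).comp hG hG', ?_⟩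
  rw [Finset.sum_add_distrib]
  have h1 : ∑ i : Fin n, G'' * (A * (2 * (X.1 - x₀) i) + h' X.2 * 0) ^ 2
      = G'' * (4 * A ^ 2 * ‖X.1 - x₀‖ ^ 2) := by
    rw [EuclideanSpace.real_norm_sq_eq, Finset.mul_sum, Finset.mul_sum]
    exact Finset.sum_congr rfl fun i _ => by ring
  rw [h1, Finset.sum_const, Finset.card_univ, Fintype.card_fin, nsmul_eq_mul]
  ring

/-- `G (A |x - x₀|² + h(t))` has zero flux when `h` is even to first order at `t = 0`. -/
lemma hasFlux_comp {σ : ℝ} (hσ : σ < 1) (x₀ : EuclideanSpace ℝ (Fin n)) (A : ℝ)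
    {h k G G' : ℝ → ℝ} {x : EuclideanSpace ℝ (Fin n)}
    (hh : ∀ t, HasDerivAt h (t * k t) t) (hk : Continuous k)
    (hG : ∀ᶠ y in 𝓝 (A * ‖x - x₀‖ ^ 2 + h 0), HasDerivAt G (G' y) y)
    (hG' : ContinuousAt G' (A * ‖x - x₀‖ ^ 2 + h 0)) :
    HasFlux σ (fun Y => G (A * ‖Y.1 - x₀‖ ^ 2 + h Y.2)) x 0 := by
  have hc : ContinuousAt (fun s => A * ‖x - x₀‖ ^ 2 + h s) 0 :=
    continuousAt_const.add (hh 0).continuousAt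
  refine HasFlux.zero_of_even hσ (k := fun s => G' (A * ‖x - x₀‖ ^ 2 + h s) * k s)
    (k₀ := G' (A * ‖x - x₀‖ ^ 2 + h 0) * k 0) ?_ ?_
  · filter_upwards [nhdsWithin_le_nhds (hc.tendsto.eventually hG)] with s hs
    convert! hs.comp s ((hh s).const_add (A * ‖x - x₀‖ ^ 2)) using 1
    ring
  · have : ContinuousAt (fun s => G' (A * ‖x - x₀‖ ^ 2 + h s) * k s) 0 :=
      (ContinuousAt.comp (x := (0 : ℝ)) (g := G') (f := fun s => A * ‖x - x₀‖ ^ 2 + h s)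
        hG' hc).mul hk.continuousAt
    exact this.tendsto.mono_left nhdsWithin_le_nhds

lemma continuous_sqn : Continuous (sqn : Pt n → ℝ) := by
  unfold sqn; fun_prop

lemma sqn_nonneg (X : Pt n) : 0 ≤ sqn X := by unfold sqn; positivity

lemma hasDerivAt_rpow_neg (k : ℝ) {y : ℝ} (hy : 0 < y) :
    HasDerivAt (fun y : ℝ => y ^ (-k)) (-k * y ^ (-k - 1)) y :=
  Real.hasDerivAt_rpow_const (Or.inl hy.ne')

/-- The extension operator on powers of the distance to the origin. -/
lemma hasL_sqn_rpow {σ : ℝ} (k : ℝ) {X : Pt n} (hX : 0 < X.2) :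
    HasL σ (fun Y => sqn Y ^ (-k)) X (2 * k * (2 * k - (n - 2 * σ)) * sqn X ^ (-k - 1)) := by
  have hpos : 0 < sqn X := by unfold sqn; positivity
  have heq : (1 : ℝ) * ‖X.1 - 0‖ ^ 2 + X.2 ^ 2 = sqn X := by simp [sqn]
  have h := hasL_comp (σ := σ) (X := X) 0 1 (h := fun t => t ^ 2) (h' := fun t => 2 * t) (h'' := 2)
    (G := fun y => y ^ (-k)) (G' := fun y => -k * y ^ (-k - 1))
    (G'' := -k * ((-k - 1) * sqn X ^ (-k - 1 - 1)))
    (Eventually.of_forall fun t => by simpa using hasDerivAt_pow 2 t)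
    (by simpa using (hasDerivAt_id X.2).const_mul 2)
    (by
      rw [heq]
      filter_upwards [lt_mem_nhds hpos] with y hy using hasDerivAt_rpow_neg k hy)
    (by
      rw [heq]
      exact (Real.hasDerivAt_rpow_const (Or.inl hpos.ne')).const_mul _)
  rw [heq] at h
  convert! h using 1
  · funext Y; simp [sqn]
  · have e1 : sqn X ^ (-k - 1) = sqn X ^ (-k - 1 - 1) * sqn X := by
      rw [← Real.rpow_add_one hpos.ne']; ring_nf
    have e2 : (4 * (1 : ℝ) ^ 2 * ‖X.1 - 0‖ ^ 2 + (2 * X.2) ^ 2) = 4 * sqn X := by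
      simp [sqn]; ring
    have e3 : (1 - 2 * σ) / X.2 * (2 * X.2) = 2 * (1 - 2 * σ) := by field_simp
    rw [e2, e3, e1]; ring

lemma hasFlux_sqn_rpow {σ : ℝ} (hσ : σ < 1) (k : ℝ) {x : EuclideanSpace ℝ (Fin n)} (hx : x ≠ 0) :
    HasFlux σ (fun Y => sqn Y ^ (-k)) x 0 := by
  have hpos : 0 < (1 : ℝ) * ‖x - 0‖ ^ 2 + 0 ^ 2 := by
    have := norm_pos_iff.2 hx
    simp only [sub_zero]; positivity
  have h := hasFlux_comp hσ 0 1 (x := x) (h := fun t => t ^ 2) (k := fun _ => 2)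
    (G := fun y => y ^ (-k)) (G' := fun y => -k * y ^ (-k - 1))
    (fun t => by simpa [mul_comm] using hasDerivAt_pow 2 t) continuous_const
    (by filter_upwards [lt_mem_nhds hpos] with y hy using hasDerivAt_rpow_neg k hy)
    (continuousAt_const.mul (Real.continuousAt_rpow_const _ _ (Or.inl hpos.ne')))
  convert! h using 1
  funext Y; simp [sqn]

end TestFunctions

section ExtensionSolution

variable {n : ℕ} {σ : ℝ} {U : Pt n → ℝ}

lemma lineJet_of_contDiffAt {X : Pt n} (hU : ContDiffAt ℝ 2 U X) (v : Pt n) :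
    LineJet U X v (fderiv ℝ U X v) (d2 U X v) := by
  have hline : ∀ s : ℝ, HasDerivAt (fun s : ℝ => X + s • v) v s := fun s => by
    simpa using ((hasDerivAt_id s).smul_const v).const_add X
  have hev : ∀ᶠ Y in 𝓝 X, DifferentiableAt ℝ U Y := by
    filter_upwards [hU.eventually (by simp)] with Y hY using hY.differentiableAt (by simp)
  have hX : X + (0 : ℝ) • v = X := by simp
  refine ⟨fun s => fderiv ℝ U (X + s • v) v, ?_, by simp, ?_⟩
  · have : Tendsto (fun s : ℝ => X + s • v) (𝓝 0) (𝓝 X) := by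
      simpa using (hline 0).continuousAt.tendsto
    filter_upwards [this.eventually hev] with s hs
    exact hs.hasFDerivAt.comp_hasDerivAt s (hline s)
  · have hd : DifferentiableAt ℝ (fun Y => fderiv ℝ U Y v) X := by
      have := (hU.fderiv_right (m := 1) (by norm_num)).differentiableAt (by simp)
      exact this.clm_apply (differentiableAt_const v)
    have h := HasFDerivAt.comp_hasDerivAt (0 : ℝ) (l := fun Y => fderiv ℝ U Y v)
      (l' := fderiv ℝ (fun Y => fderiv ℝ U Y v) X) (by rw [hX]; exact hd.hasFDerivAt) (hline 0)
    exact h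

lemma hasL_lapl {X : Pt n} (hU : ContDiffAt ℝ 2 U X) :
    HasL σ U X (lapl U X + (1 - 2 * σ) / X.2 * dt U X) :=
  ⟨_, _, _, _, fun _ => lineJet_of_contDiffAt hU _, lineJet_of_contDiffAt hU _, rfl⟩

lemma isOpen_halfBall (R : ℝ) : IsOpen {X : Pt n | enorm' X < R ∧ 0 < X.2} := by
  have : Continuous (enorm' : Pt n → ℝ) := by unfold enorm'; fun_prop
  exact (isOpen_lt this continuous_const).inter (isOpen_lt continuous_const continuous_snd)

lemma ExtSol.contDiffAt {R : ℝ} (hU : ExtSol n σ R U) {X : Pt n} (hX : enorm' X < R)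
    (ht : 0 < X.2) : ContDiffAt ℝ 2 U X :=
  hU.2.2.1.contDiffAt ((isOpen_halfBall R).mem_nhds ⟨hX, ht⟩)

lemma ExtSol.hasL {R : ℝ} (hU : ExtSol n σ R U) {X : Pt n} (hX : enorm' X < R) (ht : 0 < X.2) :
    HasL σ U X 0 := by
  rw [← hU.2.2.2.1 X hX ht]
  exact hasL_lapl (hU.contDiffAt hX ht)

lemma ExtSol.hasFlux {R : ℝ} (hU : ExtSol n σ R U) {x : EuclideanSpace ℝ (Fin n)} (hx : ‖x‖ < R)
    (hx0 : x ≠ 0) :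
    HasFlux σ U x (-(U (x, 0) ^ (((n : ℝ) + 2 * σ) / ((n : ℝ) - 2 * σ)))) := by
  refine ⟨_, ?_, hU.2.2.2.2 x hx hx0⟩
  have hc : Continuous (fun s : ℝ => enorm' ((x, s) : Pt n)) := by unfold enorm'; fun_prop
  have h0 : enorm' ((x, 0) : Pt n) < R := by simpa [enorm'] using hx
  filter_upwards [nhdsWithin_le_nhds ((hc.tendsto 0).eventually_lt_const h0), self_mem_nhdsWithin]
    with s hs hs0
  have hd : HasDerivAt (fun τ : ℝ => ((x, τ) : Pt n)) (0, 1) s :=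
    (hasDerivAt_const s x).prodMk (hasDerivAt_id s)
  exact HasFDerivAt.comp_hasDerivAt s (l := U)
    ((hU.contDiffAt (X := (x, s)) hs hs0).differentiableAt (by simp)).hasFDerivAt hd

end ExtensionSolution

section Lower

variable {n : ℕ} {σ : ℝ} {U : Pt n → ℝ}

lemma sq_enorm' (X : Pt n) : enorm' X ^ 2 = sqn X := Real.sq_sqrt (sqn_nonneg X)

lemma enorm'_le_of_sqn_le {X : Pt n} {R : ℝ} (hR : 0 ≤ R) (h : sqn X ≤ R ^ 2) : enorm' X ≤ R :=
  Real.sqrt_le_iff.2 ⟨hR, h⟩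

lemma enorm'_lt_of_sqn_lt {X : Pt n} {R : ℝ} (hR : 0 < R) (h : sqn X < R ^ 2) : enorm' X < R :=
  (Real.sqrt_lt' hR).2 h

lemma ne_zero_of_sqn_pos {X : Pt n} (h : 0 < sqn X) : X ≠ 0 := by
  rintro rfl; simp [sqn] at h

lemma isCompact_of_sqn_le {K : Set (Pt n)} (hK : IsClosed K) {R : ℝ} (hR : 0 ≤ R)
    (h : ∀ X ∈ K, sqn X ≤ R ^ 2) : IsCompact K := by
  refine Metric.isCompact_of_isClosed_isBounded hK
    ((Metric.isBounded_closedBall (x := (0 : Pt n)) (r := R)).subset fun X hX => ?_)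
  have := h X hX
  unfold sqn at this
  rw [mem_closedBall_zero_iff, Prod.norm_def, max_le_iff, Real.norm_eq_abs]
  exact ⟨abs_le_of_sq_le_sq' (by nlinarith [sq_nonneg X.2]) hR |>.2,
    abs_le_of_sq_le_sq (by nlinarith [sq_nonneg ‖X.1‖]) hR⟩

lemma ExtSol.nonneg (hU : ExtSol n σ 2 U) {X : Pt n} (h0 : 0 < sqn X) (h1 : sqn X ≤ 2 ^ 2)
    (ht : 0 ≤ X.2) : 0 ≤ U X :=
  hU.1 X (enorm'_le_of_sqn_le (by norm_num) h1) ht (ne_zero_of_sqn_pos h0)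

lemma ExtSol.continuousOn (hU : ExtSol n σ 2 U) {K : Set (Pt n)}
    (h : ∀ X ∈ K, 0 < sqn X ∧ sqn X ≤ 2 ^ 2 ∧ 0 ≤ X.2) : ContinuousOn U K :=
  hU.2.1.mono fun X hX => ⟨⟨enorm'_le_of_sqn_le (by norm_num) (h X hX).2.1, (h X hX).2.2⟩,
    ne_zero_of_sqn_pos (h X hX).1⟩

lemma continuousOn_sqn_rpow (k : ℝ) {K : Set (Pt n)} (h : ∀ X ∈ K, 0 < sqn X) :
    ContinuousOn (fun X : Pt n => sqn X ^ (-k)) K :=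
  continuous_sqn.continuousOn.rpow_const fun X hX => Or.inl (h X hX).ne'

lemma exists_rpow_neg_ge {k : ℝ} (hk : 0 < k) (B : ℝ) {ε r : ℝ} (hε : 0 < ε) (hr : 0 < r) :
    ∃ τ, 0 < τ ∧ τ ≤ r ∧ ∀ y, 0 < y → y ≤ τ → B ≤ ε * y ^ (-k) := by
  have h := (tendsto_rpow_neg_nhdsGT_zero (y := -k) (by linarith)).eventually_ge_atTop (B / ε)
  obtain ⟨δ, hδ, hall⟩ := mem_nhdsGT_iff_exists_Ioc_subset.1 h
  refine ⟨min δ r, lt_min hδ hr, min_le_right _ _, fun y hy hyτ => ?_⟩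
  have := hall ⟨hy, hyτ.trans (min_le_left _ _)⟩
  simp only [Set.mem_ofPred_eq, div_le_iff₀ hε] at this
  linarith

/-- The subsolution `1 - A|x|² - C t^{2σ} + D t²`, where `D * (4 - 4 * σ) = 2 * n * A`. -/
lemma hasL_flat_barrier (hσ : σ ∈ Set.Ioo (0 : ℝ) 1) (A C : ℝ) {X : Pt n} (hX : 0 < X.2) :
    HasL σ (fun Y => -A * ‖Y.1 - 0‖ ^ 2 +
      (1 - C * Y.2 ^ (2 * σ) + A * (n / (2 - 2 * σ)) * Y.2 ^ 2)) X 0 := by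
  obtain ⟨hσ0, hσ1⟩ := hσ
  have hrp : ∀ (p : ℝ) {t : ℝ}, 0 < t → HasDerivAt (fun t : ℝ => t ^ p) (p * t ^ (p - 1)) t :=
    fun p t ht => Real.hasDerivAt_rpow_const (Or.inl ht.ne')
  have h := hasL_comp (σ := σ) (X := X) 0 (-A)
    (h := fun t => 1 - C * t ^ (2 * σ) + A * (n / (2 - 2 * σ)) * t ^ 2)
    (h' := fun t => -(C * (2 * σ * t ^ (2 * σ - 1))) + A * (n / (2 - 2 * σ)) * (2 * t))
    (h'' := -(C * (2 * σ * ((2 * σ - 1) * X.2 ^ (2 * σ - 1 - 1))))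
      + A * (n / (2 - 2 * σ)) * 2)
    (G := fun y => y) (G' := fun _ => 1) (G'' := 0)
    (by
      filter_upwards [lt_mem_nhds hX] with t ht
      exact (((hrp _ ht).const_mul C).const_sub 1).add
        ((by simpa using hasDerivAt_pow 2 t :
          HasDerivAt (fun t : ℝ => t ^ 2) (2 * t) t).const_mul _))
    (((((hrp _ hX).const_mul (2 * σ)).const_mul C).neg).add
      ((by simpa using (hasDerivAt_id X.2).const_mul 2 :
        HasDerivAt (fun t : ℝ => 2 * t) 2 X.2).const_mul _))
    (Eventually.of_forall fun y => hasDerivAt_id y) (hasDerivAt_const _ _)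
  convert! h using 1
  have e : X.2 ^ (2 * σ - 1) = X.2 ^ (2 * σ - 1 - 1) * X.2 := by
    rw [← Real.rpow_add_one hX.ne']; ring_nf
  have hs : (2 - 2 * σ) ≠ 0 := by linarith
  rw [e]
  field_simp
  ring

lemma exists_flat_barrier (hσ : σ ∈ Set.Ioo (0 : ℝ) 1) {ρ δ : ℝ} (hρ : 0 < ρ) (hδ : 0 < δ)
    (hδC : δ ^ 2 + (1 + n / (2 - 2 * σ)) * δ ^ (2 * σ) ≤ 1 / 2) :
    ∃ φ : Pt n → ℝ, Continuous φ ∧ (∀ Y, 0 < Y.2 → HasL σ φ Y 0) ∧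
      (∀ Y, 0 ≤ Y.2 → sqn Y ≤ ρ ^ 2 → φ Y ≤ 1) ∧ (∀ Y, 0 ≤ Y.2 → sqn Y = ρ ^ 2 → φ Y ≤ 0) ∧
      ∀ Y, 0 ≤ Y.2 → sqn Y ≤ (δ * ρ) ^ 2 → 1 / 2 ≤ φ Y := by
  have hσ' := hσ
  obtain ⟨hσ0, hσ1⟩ := hσ
  set D : ℝ := n / (2 - 2 * σ) with hD
  have hDpos : 0 ≤ D := div_nonneg (Nat.cast_nonneg n) (by linarith)
  set φ : Pt n → ℝ := fun Y => -(1 / ρ ^ 2) * ‖Y.1 - 0‖ ^ 2 +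
      (1 - (1 + D) / ρ ^ (2 * σ) * Y.2 ^ (2 * σ) + 1 / ρ ^ 2 * D * Y.2 ^ 2) with hφ
  have hφeq : ∀ Y : Pt n, 0 ≤ Y.2 →
      φ Y = 1 - ‖Y.1‖ ^ 2 / ρ ^ 2 - (1 + D) * (Y.2 / ρ) ^ (2 * σ) + D * (Y.2 / ρ) ^ 2 := by
    intro Y hY
    simp only [hφ, Real.div_rpow hY hρ.le, sub_zero]
    ring
  have hsle : ∀ Y : Pt n, 0 ≤ Y.2 → sqn Y ≤ ρ ^ 2 →
      0 ≤ (Y.2 / ρ) ^ 2 ∧ (Y.2 / ρ) ^ 2 ≤ (Y.2 / ρ) ^ (2 * σ) := by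
    intro Y h0 h1
    have h2 : Y.2 / ρ ≤ 1 := by
      refine (div_le_one hρ).2 (abs_le_of_sq_le_sq' ?_ hρ.le).2
      unfold sqn at h1; linarith [sq_nonneg ‖Y.1‖]
    refine ⟨by positivity, ?_⟩
    rw [← Real.rpow_two]
    exact Real.rpow_le_rpow_of_exponent_ge' (by positivity) h2 (by linarith) (by linarith)
  refine ⟨φ, ?_, fun Y hY => hasL_flat_barrier hσ' _ _ hY, ?_, ?_, ?_⟩
  · have : Continuous fun Y : Pt n => Y.2 ^ (2 * σ) :=
      continuous_snd.rpow_const fun _ => Or.inr (by linarith)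
    fun_prop
  · intro Y h0 h1
    obtain ⟨hs0, hs1⟩ := hsle Y h0 h1
    have h2 : 0 ≤ ‖Y.1‖ ^ 2 / ρ ^ 2 := by positivity
    have h3 := mul_le_mul_of_nonneg_left hs1 hDpos
    rw [hφeq Y h0]
    linarith
  · intro Y h0 h1
    obtain ⟨hs0, hs1⟩ := hsle Y h0 h1.le
    have h2 : ‖Y.1‖ ^ 2 / ρ ^ 2 = 1 - (Y.2 / ρ) ^ 2 := by
      rw [div_pow, eq_sub_iff_add_eq, ← add_div, div_eq_one_iff_eq (by positivity)]
      exact h1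
    have h3 := mul_le_mul_of_nonneg_left hs1 hDpos
    rw [hφeq Y h0, h2]
    linarith
  · intro Y h0 h1
    have hx : ‖Y.1‖ ^ 2 / ρ ^ 2 ≤ δ ^ 2 := by
      rw [div_le_iff₀ (by positivity), ← mul_pow]
      unfold sqn at h1; linarith [sq_nonneg Y.2]
    have hs : Y.2 / ρ ≤ δ := by
      rw [div_le_iff₀ hρ]
      refine (abs_le_of_sq_le_sq' ?_ (by positivity)).2
      unfold sqn at h1; linarith [sq_nonneg ‖Y.1‖]
    have h2 : (Y.2 / ρ) ^ (2 * σ) ≤ δ ^ (2 * σ) :=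
      Real.rpow_le_rpow (by positivity) hs (by linarith)
    have h3 := mul_le_mul_of_nonneg_left h2 (by linarith : 0 ≤ 1 + D)
    have h4 : 0 ≤ D * (Y.2 / ρ) ^ 2 := by positivity
    rw [hφeq Y h0]
    linarith

/-- Lower bound near the origin in terms of a lower bound on the trace on a ball. -/
lemma lower_bound_near_zero (hσ : σ ∈ Set.Ioo (0 : ℝ) 1) (hn : 2 ≤ n) (hU : ExtSol n σ 2 U)
    {c ρ δ : ℝ} (hc : 0 < c) (hρ : 0 < ρ) (hρ1 : ρ < 1)
    (hflat : ∀ x : EuclideanSpace ℝ (Fin n), x ≠ 0 → ‖x‖ ≤ ρ → c ≤ U (x, 0))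
    (hδ : 0 < δ) (hδC : δ ^ 2 + (1 + n / (2 - 2 * σ)) * δ ^ (2 * σ) ≤ 1 / 2)
    {X : Pt n} (ht : 0 ≤ X.2) (hX0 : 0 < sqn X) (hX : sqn X ≤ (δ * ρ) ^ 2) : c / 2 ≤ U X := by
  obtain ⟨φ, hφc, hφL, hφ1, hφ0, hφX⟩ := exists_flat_barrier (n := n) hσ hρ hδ hδC
  obtain ⟨hσ0, hσ1⟩ := hσ
  have hn' : (2 : ℝ) ≤ n := by exact_mod_cast hn
  set k : ℝ := (n - 2 * σ) / 4 with hk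
  have hkpos : 0 < k := by rw [hk]; linarith
  have hXρ : sqn X ≤ ρ ^ 2 := by
    refine hX.trans ?_
    have : δ ^ 2 ≤ 1 := by
      have : 0 ≤ (1 + n / (2 - 2 * σ)) * δ ^ (2 * σ) :=
        mul_nonneg (add_nonneg zero_le_one (div_nonneg (by linarith) (by linarith)))
          (Real.rpow_nonneg hδ.le _)
      linarith
    rw [mul_pow]; exact mul_le_of_le_one_left (sq_nonneg ρ) this
  have hρ2 : ρ ^ 2 ≤ 1 := pow_le_one₀ hρ.le hρ1.le
  have key : ∀ ε : ℝ, 0 < ε → c * φ X ≤ U X + ε * sqn X ^ (-k) := by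
    intro ε hε
    obtain ⟨τ, hτ0, hτX, hτ⟩ := exists_rpow_neg_ge hkpos c hε hX0
    set K : Set (Pt n) := {Y | τ ≤ sqn Y ∧ sqn Y ≤ ρ ^ 2 ∧ 0 ≤ Y.2} with hK
    have hKc : IsClosed K :=
      (isClosed_le continuous_const continuous_sqn).inter
        ((isClosed_le continuous_sqn continuous_const).inter
          (isClosed_le continuous_const continuous_snd))
    have hmain := nonneg_of_strict_supersolution (σ := σ)
      (isCompact_of_sqn_le hKc hρ.le fun Y hY => hY.2.1)
      (W := fun Y => U Y + ε * sqn Y ^ (-k) + -c * φ Y)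
      (((hU.continuousOn fun Y hY => ⟨hτ0.trans_le hY.1, by linarith [hY.2.1], hY.2.2⟩).add
        ((continuousOn_sqn_rpow k fun Y hY => hτ0.trans_le hY.1).const_smul ε)).add
        (hφc.continuousOn.const_smul (-c))) ?_ X ⟨hτX, hXρ, ht⟩
    · linarith
    rintro Y ⟨hYτ, hYρ, hYt⟩ hneg
    have hY0 : 0 < sqn Y := hτ0.trans_le hYτ
    have hUY : 0 ≤ U Y := hU.nonneg hY0 (by linarith) hYt
    have hΓ : 0 < sqn Y ^ (-k) := Real.rpow_pos_of_pos hY0 _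
    have hφY := hφ1 Y hYt hYρ
    have hcφ : c * φ Y ≤ c := mul_le_of_le_one_right hc.le hφY
    have hεΓ : 0 < ε * sqn Y ^ (-k) := mul_pos hε hΓ
    have h1 : τ < sqn Y := by
      by_contra! h
      have := hτ _ hY0 h
      linarith
    have h2 : sqn Y < ρ ^ 2 := by
      refine lt_of_le_of_ne hYρ fun h => ?_
      have := mul_nonneg hc.le (neg_nonneg.2 (hφ0 Y hYt h))
      linarith
    have h3 : 0 < Y.2 := by
      refine lt_of_le_of_ne hYt fun h => ?_
      have hY : Y = (Y.1, 0) := Prod.ext rfl h.symm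
      have hYsq : sqn Y = ‖Y.1‖ ^ 2 := by rw [hY]; simp [sqn]
      have hc' : c ≤ U Y := by
        rw [hY]
        refine hflat _ (fun h => ?_) (abs_le_of_sq_le_sq' (hYsq ▸ hYρ) hρ.le).2
        rw [hYsq, h] at hY0; simp at hY0
      linarith
    refine Or.inl ⟨?_, _, ?_, ((hU.hasL (enorm'_lt_of_sqn_lt (by norm_num) (by linarith)) h3).add
      ((hasL_sqn_rpow k h3).const_mul ε)).add
      ((hφL Y h3).const_mul (-c))⟩
    · have ho : IsOpen {Y : Pt n | τ < sqn Y ∧ sqn Y < ρ ^ 2 ∧ 0 < Y.2} :=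
        (isOpen_lt continuous_const continuous_sqn).inter
          ((isOpen_lt continuous_sqn continuous_const).inter
            (isOpen_lt continuous_const continuous_snd))
      filter_upwards [ho.mem_nhds ⟨h1, h2, h3⟩] with Z hZ
      exact ⟨hZ.1.le, hZ.2.1.le, hZ.2.2.le⟩
    · have hp : 0 < sqn Y ^ (-k - 1) := Real.rpow_pos_of_pos hY0 _
      have : 2 * k - (n - 2 * σ) = -(2 * k) := by rw [hk]; ring
      rw [this]
      have : 0 < ε * (2 * k * (2 * k) * sqn Y ^ (-k - 1)) := by positivity
      linarith
  have hΓX : 0 < sqn X ^ (-k) := Real.rpow_pos_of_pos hX0 _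
  have : c * φ X ≤ U X := by
    refine le_of_forall_pos_le_add fun ε hε => ?_
    have := key (ε / sqn X ^ (-k)) (by positivity)
    rwa [div_mul_cancel₀ _ hΓX.ne'] at this
  have := mul_le_mul_of_nonneg_left (hφX X ht hX) hc.le
  linarith

/-- Propagation of a positive lower bound across an annulus. -/
lemma lower_bound_annulus (hσ : σ ∈ Set.Ioo (0 : ℝ) 1) (hn : 2 ≤ n) (hU : ExtSol n σ 2 U)
    {b s₀ : ℝ} (hb : 0 < b) (hs₀ : 0 < s₀)
    (hflat : ∀ x : EuclideanSpace ℝ (Fin n), x ≠ 0 → ‖x‖ ≤ 3 / 4 → b ≤ U (x, 0))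
    (hinner : ∀ X : Pt n, 0 ≤ X.2 → sqn X = s₀ → b ≤ U X) :
    ∃ b' > 0, ∀ X : Pt n, 0 ≤ X.2 → s₀ ≤ sqn X → sqn X ≤ (1 / 2) ^ 2 → b' ≤ U X := by
  have hn' : (2 : ℝ) ≤ n := by exact_mod_cast hn
  obtain ⟨hσ0, hσ1⟩ := hσ
  set k : ℝ := n / 2 with hk
  have hkpos : 0 < k := by rw [hk]; linarith
  have hp0 : 0 < s₀ ^ (-k) := Real.rpow_pos_of_pos hs₀ _
  set η : ℝ := b / s₀ ^ (-k) with hη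
  have hηpos : 0 < η := by positivity
  set a : ℝ := (((3 : ℝ) / 4) ^ 2) ^ (-k) with ha
  have hapos : 0 < a := Real.rpow_pos_of_pos (by norm_num) _
  have hgap : a < (((1 : ℝ) / 2) ^ 2) ^ (-k) :=
    Real.rpow_lt_rpow_of_neg (by norm_num) (by norm_num) (by linarith)
  refine ⟨η * ((((1 : ℝ) / 2) ^ 2) ^ (-k) - a), mul_pos hηpos (by linarith), ?_⟩
  intro X ht hXs hX
  set K : Set (Pt n) := {Y | s₀ ≤ sqn Y ∧ sqn Y ≤ (3 / 4) ^ 2 ∧ 0 ≤ Y.2} with hK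
  have hKc : IsClosed K :=
    (isClosed_le continuous_const continuous_sqn).inter
      ((isClosed_le continuous_sqn continuous_const).inter
        (isClosed_le continuous_const continuous_snd))
  have hηle : ∀ y, s₀ ≤ y → η * y ^ (-k) ≤ b := by
    intro y hy
    have := Real.rpow_le_rpow_of_nonpos hs₀ hy (by linarith : -k ≤ 0)
    calc η * y ^ (-k) ≤ η * s₀ ^ (-k) := by gcongr
      _ = b := by rw [hη]; field_simp
  have hmain := nonneg_of_strict_supersolution (σ := σ)
    (isCompact_of_sqn_le hKc (by norm_num) fun Y hY => hY.2.1)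
    (W := fun Y => U Y + -η * sqn Y ^ (-k) + η * a)
    (((hU.continuousOn fun Y hY => ⟨hs₀.trans_le hY.1, by linarith [hY.2.1], hY.2.2⟩).add
      ((continuousOn_sqn_rpow k fun Y hY => hs₀.trans_le hY.1).const_smul (-η))).add
      continuousOn_const) ?_ X ⟨hXs, by linarith, ht⟩
  · have hX0 : 0 < sqn X := hs₀.trans_le hXs
    have h1 : (((1 : ℝ) / 2) ^ 2) ^ (-k) ≤ sqn X ^ (-k) :=
      Real.rpow_le_rpow_of_nonpos hX0 hX (by linarith)
    have h2 : η * (((1 : ℝ) / 2) ^ 2) ^ (-k) ≤ η * sqn X ^ (-k) := by gcongr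
    linarith
  rintro Y ⟨hYs, hYρ, hYt⟩ hneg
  have hY0 : 0 < sqn Y := hs₀.trans_le hYs
  have hUY : 0 ≤ U Y := hU.nonneg hY0 (by linarith) hYt
  have hle := hηle _ hYs
  have hηa : 0 < η * a := by positivity
  have h1 : s₀ < sqn Y := by
    refine lt_of_le_of_ne hYs fun h => ?_
    have := hinner Y hYt h.symm
    linarith
  have h2 : sqn Y < (3 / 4) ^ 2 := by
    refine lt_of_le_of_ne hYρ fun h => ?_
    rw [h, ← ha] at hneg
    linarith
  have h3 : 0 < Y.2 := by
    refine lt_of_le_of_ne hYt fun h => ?_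
    have hY : Y = (Y.1, 0) := Prod.ext rfl h.symm
    have hYsq : sqn Y = ‖Y.1‖ ^ 2 := by rw [hY]; simp [sqn]
    have hc' : b ≤ U Y := by
      rw [hY]
      refine hflat _ (fun h => ?_) (abs_le_of_sq_le_sq' (hYsq ▸ hYρ) (by norm_num)).2
      rw [hYsq, h] at hY0; simp at hY0
    linarith
  refine Or.inl ⟨?_, _, ?_, ((hU.hasL (enorm'_lt_of_sqn_lt (by norm_num) (by linarith)) h3).add
    ((hasL_sqn_rpow k h3).const_mul (-η))).add (HasL.const (η * a))⟩
  · have ho : IsOpen {Y : Pt n | s₀ < sqn Y ∧ sqn Y < (3 / 4) ^ 2 ∧ 0 < Y.2} :=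
      (isOpen_lt continuous_const continuous_sqn).inter
        ((isOpen_lt continuous_sqn continuous_const).inter
          (isOpen_lt continuous_const continuous_snd))
    filter_upwards [ho.mem_nhds ⟨h1, h2, h3⟩] with Z hZ
    exact ⟨hZ.1.le, hZ.2.1.le, hZ.2.2.le⟩
  · have hp : 0 < sqn Y ^ (-k - 1) := Real.rpow_pos_of_pos hY0 _
    have : 2 * k - (n - 2 * σ) = 2 * σ := by rw [hk]; ring
    rw [this]
    have : 0 < η * (2 * k * (2 * σ) * sqn Y ^ (-k - 1)) := by positivity
    linarith

lemma exists_small_radius (hσ : 0 < σ) (C : ℝ) :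
    ∃ δ : ℝ, 0 < δ ∧ δ ^ 2 + C * δ ^ (2 * σ) ≤ 1 / 2 := by
  have hc : ContinuousAt (fun δ : ℝ => δ ^ 2 + C * δ ^ (2 * σ)) 0 :=
    (continuousAt_id.pow 2).add (continuousAt_const.mul
      (Real.continuousAt_rpow_const _ _ (Or.inr (by linarith))))
  have h0 : (0 : ℝ) ^ 2 + C * 0 ^ (2 * σ) < 1 / 2 := by
    rw [Real.zero_rpow (by linarith)]; norm_num
  have := (hc.eventually_lt_const h0).filter_mono (nhdsWithin_le_nhds (s := Set.Ioi 0))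
  obtain ⟨δ, h1, h2⟩ := (this.and self_mem_nhdsWithin).exists
  exact ⟨δ, h2, h1.le⟩

theorem lower_bound (hσ : σ ∈ Set.Ioo (0 : ℝ) 1) (hn : 2 ≤ n) (hU : ExtSol n σ 2 U)
    {c₁ : ℝ} (hc₁ : 0 < c₁)
    (hbd : ∀ x : EuclideanSpace ℝ (Fin n), 0 < ‖x‖ → ‖x‖ < 1 →
      c₁ * ‖x‖ ^ (-(((n : ℝ) - 2 * σ) / 2)) ≤ U (x, 0)) :
    ∃ C₁ : ℝ, 0 < C₁ ∧ ∀ X : Pt n, 0 ≤ X.2 → 0 < enorm' X → enorm' X ≤ 1 / 2 →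
      C₁ * enorm' X ^ (-(((n : ℝ) - 2 * σ) / 2)) ≤ U X := by
  have hn' : (2 : ℝ) ≤ n := by exact_mod_cast hn
  set γ : ℝ := ((n : ℝ) - 2 * σ) / 2 with hγ
  have hγpos : 0 < γ := by rw [hγ]; linarith [hσ.2]
  obtain ⟨δ, hδ, hδC⟩ := exists_small_radius hσ.1 (1 + (n : ℝ) / (2 - 2 * σ))
  have hflat : ∀ ρ < 1, ∀ x : EuclideanSpace ℝ (Fin n), x ≠ 0 → ‖x‖ ≤ ρ →
      c₁ * ρ ^ (-γ) ≤ U (x, 0) := by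
    intro ρ hρ1 x hx hxρ
    have hx0 := norm_pos_iff.2 hx
    refine le_trans ?_ (hbd x hx0 (by linarith))
    have := Real.rpow_le_rpow_of_nonpos hx0 hxρ (by linarith : -γ ≤ 0)
    gcongr
  have hnear : ∀ ρ : ℝ, 0 < ρ → ρ < 1 → ∀ X : Pt n, 0 ≤ X.2 → 0 < sqn X → sqn X ≤ (δ * ρ) ^ 2 →
      c₁ * ρ ^ (-γ) / 2 ≤ U X := by
    intro ρ hρ hρ1 X ht hX0 hX
    have hp : 0 < ρ ^ (-γ) := Real.rpow_pos_of_pos hρ _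
    exact lower_bound_near_zero hσ hn hU (by positivity) hρ hρ1 (hflat ρ hρ1) hδ hδC ht hX0 hX
  set b : ℝ := c₁ * (3 / 4 : ℝ) ^ (-γ) / 2 with hb
  have hbpos : 0 < b := by
    have : 0 < (3 / 4 : ℝ) ^ (-γ) := Real.rpow_pos_of_pos (by norm_num) _
    positivity
  obtain ⟨b', hb', hann⟩ := lower_bound_annulus (s₀ := (δ * (3 / 4)) ^ 2) hσ hn hU hbpos
    (by positivity)
    (fun x hx hxρ => le_trans (by rw [hb]; rw [hb] at hbpos; linarith)
      (hflat (3 / 4) (by norm_num) x hx hxρ))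
    (fun X ht hX => hnear (3 / 4) (by norm_num) (by norm_num) X ht
      (by rw [hX]; positivity) hX.le)
  have hδp : 0 < δ ^ γ := Real.rpow_pos_of_pos hδ _
  have hp : 0 < (δ * (3 / 4)) ^ γ := Real.rpow_pos_of_pos (by positivity) _
  refine ⟨min (c₁ * δ ^ γ / 2) (b' * (δ * (3 / 4)) ^ γ), by positivity, ?_⟩
  intro X ht hX0 hX
  have hsX : 0 < sqn X := by rw [← sq_enorm']; positivity
  have hpX : 0 < enorm' X ^ (-γ) := Real.rpow_pos_of_pos hX0 _
  rcases le_total (enorm' X) (δ * (3 / 4)) with h | h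
  · have h1 := hnear (enorm' X / δ) (by positivity)
      (by rw [div_lt_one hδ]; linarith) X ht hsX
      (by rw [mul_div_cancel₀ _ hδ.ne', sq_enorm'])
    rw [Real.div_rpow hX0.le hδ.le, Real.rpow_neg hδ.le, div_inv_eq_mul] at h1
    calc _ ≤ c₁ * δ ^ γ / 2 * enorm' X ^ (-γ) := by gcongr; exact min_le_left _ _
      _ = c₁ * (enorm' X ^ (-γ) * δ ^ γ) / 2 := by ring
      _ ≤ U X := h1
  · have h1 := hann X ht (by rw [← sq_enorm']; gcongr) (by rw [← sq_enorm']; gcongr)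
    have h2 : (δ * (3 / 4)) ^ γ * enorm' X ^ (-γ) ≤ 1 := by
      rw [Real.rpow_neg hX0.le, ← div_eq_mul_inv, div_le_one (by positivity)]
      exact Real.rpow_le_rpow (by positivity) h hγpos.le
    calc _ ≤ b' * (δ * (3 / 4)) ^ γ * enorm' X ^ (-γ) := by gcongr; exact min_le_right _ _
      _ = b' * ((δ * (3 / 4)) ^ γ * enorm' X ^ (-γ)) := by ring
      _ ≤ b' * 1 := by gcongr
      _ ≤ U X := by linarith

end Lower

section Mean

variable {n : ℕ}

instance : (volume : Measure (Pt n)).IsAddHaarMeasure :=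
  inferInstanceAs (Measure.prod volume volume).IsAddHaarMeasure

/-- The truncated paraboloid `(1 - |y|²)⁺`. -/
def paraboloid (y : Pt n) : ℝ := max (1 - sqn y) 0

/-- The closed Euclidean unit ball. -/
def unitBall (n : ℕ) : Set (Pt n) := {y | sqn y ≤ 1}

lemma continuous_paraboloid : Continuous (paraboloid : Pt n → ℝ) :=
  (continuous_const.sub continuous_sqn).max continuous_const

lemma paraboloid_nonneg (y : Pt n) : 0 ≤ paraboloid y := le_max_right _ _

lemma paraboloid_le_one (y : Pt n) : paraboloid y ≤ 1 :=
  max_le (by linarith [sqn_nonneg y]) zero_le_one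

lemma paraboloid_eq_zero {y : Pt n} (hy : y ∉ unitBall n) : paraboloid y = 0 :=
  max_eq_right (by simp only [unitBall, Set.mem_ofPred_eq, not_le] at hy; linarith)

lemma isClosed_unitBall : IsClosed (unitBall n) := isClosed_le continuous_sqn continuous_const

lemma isCompact_unitBall : IsCompact (unitBall n) :=
  isCompact_of_sqn_le isClosed_unitBall zero_le_one fun y hy => by rw [one_pow]; exact hy

lemma measurableSet_unitBall : MeasurableSet (unitBall n) := isClosed_unitBall.measurableSet

lemma integral_paraboloid_pos : 0 < ∫ y in unitBall n, paraboloid y := by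
  rw [setIntegral_eq_integral_of_forall_compl_eq_zero fun y hy => paraboloid_eq_zero hy]
  refine continuous_paraboloid.integral_pos_of_hasCompactSupport_nonneg_nonzero
    (HasCompactSupport.of_support_subset_isCompact isCompact_unitBall fun y hy => ?_)
    paraboloid_nonneg (x := 0) (by simp [paraboloid, sqn])
  by_contra h
  exact hy (paraboloid_eq_zero h)

lemma hasDerivAt_sq_max_zero (s : ℝ) :
    HasDerivAt (fun s : ℝ => max s 0 ^ 2) (2 * max s 0) s := by
  rcases lt_trichotomy s 0 with h | rfl | h
  · rw [max_eq_right h.le, mul_zero]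
    refine (hasDerivAt_const s (0 : ℝ)).congr_of_eventuallyEq ?_
    filter_upwards [gt_mem_nhds h] with u hu
    simp [max_eq_right hu.le]
  · have : (fun s : ℝ => max s 0 ^ 2) =O[𝓝 0] fun s => ‖s - 0‖ ^ 2 := by
      refine Asymptotics.IsBigO.of_bound 1 (Eventually.of_forall fun s => ?_)
      rw [sub_zero, norm_pow, norm_pow, norm_norm, one_mul]
      gcongr
      simpa [Real.norm_eq_abs] using abs_max_le_max_abs_abs (a := s) (b := 0)
    simpa using (this.hasFDerivAt (𝕜 := ℝ) one_lt_two).hasDerivAt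
  · rw [max_eq_left h.le]
    refine (by simpa using hasDerivAt_pow 2 s :
      HasDerivAt (fun s : ℝ => s ^ 2) (2 * s) s).congr_of_eventuallyEq ?_
    filter_upwards [lt_mem_nhds h] with u hu
    simp [max_eq_left hu.le]

lemma hasLineDerivAt_sq_paraboloid (y v : Pt n) :
    HasLineDerivAt ℝ (fun y : Pt n => paraboloid y ^ 2)
      (-(4 * (paraboloid y * (⟪y.1, v.1⟫ + y.2 * v.2)))) y v := by
  have h1 : HasDerivAt (fun s : ℝ => 1 - sqn (y + s • v)) (-(2 * (⟪y.1, v.1⟫ + y.2 * v.2))) 0 := by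
    have h2 : HasDerivAt (fun s : ℝ => (y + s • v).1) v.1 0 := by
      simpa using ((hasDerivAt_id (0 : ℝ)).smul_const v.1).const_add y.1
    have h3 : HasDerivAt (fun s : ℝ => (y + s • v).2) v.2 0 := by
      simpa using ((hasDerivAt_id (0 : ℝ)).mul_const v.2).const_add y.2
    convert! (h2.norm_sq.add (h3.pow 2)).const_sub 1 using 1
    simp; ring
  have h0 : (1 : ℝ) - sqn (y + (0 : ℝ) • v) = 1 - sqn y := by simp
  have := HasDerivAt.comp (0 : ℝ) (hasDerivAt_sq_max_zero _) h1
  rw [h0] at this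
  have h2 : 2 * max (1 - sqn y) 0 * -(2 * (⟪y.1, v.1⟫ + y.2 * v.2)) =
      -(4 * (paraboloid y * (⟪y.1, v.1⟫ + y.2 * v.2))) := by unfold paraboloid; ring
  rwa [h2] at this

/-- Integration by parts against the squared paraboloid. -/
lemma setIntegral_sq_paraboloid_mul {g g' : Pt n → ℝ} {v : Pt n}
    (hg : ContinuousOn g (unitBall n)) (hg' : ContinuousOn g' (unitBall n))
    (h : ∀ y ∈ unitBall n, HasLineDerivAt ℝ g (g' y) y v) :
    ∫ y in unitBall n, paraboloid y ^ 2 * g' y =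
      4 * ∫ y in unitBall n, paraboloid y * (⟪y.1, v.1⟫ + y.2 * v.2) * g y := by
  have hint : ∀ {p q : Pt n → ℝ}, Continuous p → (∀ y ∉ unitBall n, p y = 0) →
      ContinuousOn q (unitBall n) → Integrable (fun y => p y * q y) := by
    intro p q hp hp0 hq
    exact ((hp.continuousOn.mul hq).integrableOn_compact
      isCompact_unitBall).integrable_of_forall_notMem_eq_zero fun y hy => by simp [hp0 y hy]
  have hp : Continuous fun y : Pt n => paraboloid y := continuous_paraboloid
  have hsupp : tsupport (fun y : Pt n => paraboloid y ^ 2) ⊆ unitBall n := by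
    refine closure_minimal (fun y hy => ?_) isClosed_unitBall
    by_contra h
    exact hy (by simp [paraboloid_eq_zero h])
  have := integral_bilinear_hasLineDerivAt_right_eq_neg_left_of_integrable (μ := volume)
    (B := ContinuousLinearMap.mul ℝ ℝ) (f := fun y : Pt n => paraboloid y ^ 2)
    (f' := fun y => -(4 * (paraboloid y * (⟪y.1, v.1⟫ + y.2 * v.2)))) (g := g) (g' := g') (v := v)
    (hint (by fun_prop) (fun y hy => by simp [paraboloid_eq_zero hy]) hg)
    (hint (by fun_prop) (fun y hy => by simp [paraboloid_eq_zero hy]) hg')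
    (hint (by fun_prop) (fun y hy => by simp [paraboloid_eq_zero hy]) hg)
    (fun y _ => hasLineDerivAt_sq_paraboloid y v) (fun y hy => h y (hsupp hy))
  simp only [ContinuousLinearMap.mul_apply'] at this
  rw [setIntegral_eq_integral_of_forall_compl_eq_zero fun y hy => by simp [paraboloid_eq_zero hy],
    setIntegral_eq_integral_of_forall_compl_eq_zero fun y hy => by simp [paraboloid_eq_zero hy],
    this, ← integral_neg, ← integral_const_mul]
  congr 1 with y
  ring

lemma hasLineDerivAt_comp_affine {G : Pt n → ℝ} {X y : Pt n} {r : ℝ}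
    (hG : DifferentiableAt ℝ G (X + r • y)) (v : Pt n) :
    HasLineDerivAt ℝ (fun y => G (X + r • y)) (r * fderiv ℝ G (X + r • y) v) y v := by
  have h1 : HasDerivAt (fun s : ℝ => X + r • (y + s • v)) (r • v) 0 := by
    simpa using ((((hasDerivAt_id (0 : ℝ)).smul_const v).const_add y).const_smul r).const_add X
  have h2 : HasFDerivAt G (fderiv ℝ G (X + r • y)) (X + r • (y + (0 : ℝ) • v)) := by
    simpa using hG.hasFDerivAt
  have := h2.comp_hasDerivAt (0 : ℝ) h1
  rwa [map_smul, smul_eq_mul] at this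

end Mean

section Harnack

variable {n : ℕ} {U : Pt n → ℝ}

/-- The unnormalised weighted mean of `U` over the ball of radius `|r|` about `X`. -/
def wmean (U : Pt n → ℝ) (X : Pt n) (r : ℝ) : ℝ :=
  ∫ y in unitBall n, paraboloid y * U (X + r • y)

/-- `U ≥ 0` solves `ΔU + (a/t) ∂_t U = 0` in an open set containing the ball of radius `t/2`
about `X = (x, t)`. -/
structure InteriorSol (a : ℝ) (U : Pt n → ℝ) (O : Set (Pt n)) (X : Pt n) : Prop where
  isOpen : IsOpen O
  contDiffOn : ContDiffOn ℝ 2 U O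
  nonneg : ∀ Y ∈ O, 0 ≤ U Y
  eq : ∀ Y ∈ O, lapl U Y + a / Y.2 * dt U Y = 0
  pos : 0 < X.2
  mem : ∀ r : ℝ, |r| ≤ X.2 / 2 → ∀ y ∈ unitBall n, X + r • y ∈ O

lemma abs_snd_le_one {y : Pt n} (hy : y ∈ unitBall n) : |y.2| ≤ 1 := by
  rw [← sq_le_one_iff_abs_le_one]
  have : ‖y.1‖ ^ 2 + y.2 ^ 2 ≤ 1 := hy
  linarith [sq_nonneg ‖y.1‖]

lemma half_le_snd {X y : Pt n} {r : ℝ} (hr : |r| ≤ X.2 / 2) (hy : y ∈ unitBall n) :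
    X.2 / 2 ≤ (X + r • y).2 := by
  have h1 : |r * y.2| ≤ X.2 / 2 := by
    rw [abs_mul]
    exact (mul_le_of_le_one_right (abs_nonneg _) (abs_snd_le_one hy)).trans hr
  have := (abs_le.1 h1).1
  simp only [Prod.snd_add, Prod.smul_snd, smul_eq_mul]
  linarith

lemma sum_coord (L : Pt n →L[ℝ] ℝ) (y : Pt n) :
    L y = (∑ i, y.1 i * L (EuclideanSpace.single i (1 : ℝ), (0 : ℝ))) + y.2 * L (0, 1) := by
  have h1 : y = (∑ i, y.1 i • ((EuclideanSpace.single i (1 : ℝ), (0 : ℝ)) : Pt n))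
      + y.2 • ((0, 1) : Pt n) := by
    refine Prod.ext ?_ ?_
    · ext j
      simp [Prod.fst_sum, Pi.single_apply]
    · simp [Prod.snd_sum]
  conv_lhs => rw [h1]
  simp only [map_add, map_sum, map_smul, smul_eq_mul]

namespace InteriorSol

variable {a : ℝ} {O : Set (Pt n)} {X : Pt n} {r : ℝ}

lemma continuousOn_fderiv (h : InteriorSol a U O X) : ContinuousOn (fderiv ℝ U) O :=
  h.contDiffOn.continuousOn_fderiv_of_isOpen h.isOpen (by norm_num)

lemma differentiableAt (h : InteriorSol a U O X) {Y : Pt n} (hY : Y ∈ O) :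
    DifferentiableAt ℝ U Y :=
  (h.contDiffOn.contDiffAt (h.isOpen.mem_nhds hY)).differentiableAt (by norm_num)

lemma contDiffOn_fderiv_apply (h : InteriorSol a U O X) (v : Pt n) :
    ContDiffOn ℝ 1 (fun Y => fderiv ℝ U Y v) O :=
  (h.contDiffOn.fderiv_of_isOpen h.isOpen (by norm_num)).clm_apply contDiffOn_const

lemma continuousOn_comp (h : InteriorSol a U O X) (hr : |r| ≤ X.2 / 2) {G : Pt n → ℝ}
    (hG : ContinuousOn G O) : ContinuousOn (fun y => G (X + r • y)) (unitBall n) :=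
  hG.comp (by fun_prop) fun y hy => h.mem r hr y hy

lemma hasDerivAt_wmean (h : InteriorSol a U O X) (hr : |r| < X.2 / 2) :
    HasDerivAt (wmean U X)
      (∫ y in unitBall n, paraboloid y * fderiv ℝ U (X + r • y) y) r := by
  set I : Set ℝ := Set.Icc (-(X.2 / 2)) (X.2 / 2) with hI
  have hmaps : Set.MapsTo (fun p : ℝ × Pt n => X + p.1 • p.2) (I ×ˢ unitBall n) O :=
    fun p hp => h.mem p.1 (abs_le.2 hp.1) p.2 hp.2
  have hcont : ContinuousOn (fun p : ℝ × Pt n => paraboloid p.2 *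
      fderiv ℝ U (X + p.1 • p.2) p.2) (I ×ˢ unitBall n) :=
    (continuous_paraboloid.comp continuous_snd).continuousOn.mul
      ((h.continuousOn_fderiv.comp (by fun_prop) hmaps).clm_apply continuousOn_snd)
  obtain ⟨C, hC⟩ := (isCompact_Icc.prod isCompact_unitBall).exists_bound_of_continuousOn hcont
  have hcU : ∀ s, |s| ≤ X.2 / 2 →
      ContinuousOn (fun y => paraboloid y * U (X + s • y)) (unitBall n) := fun s hs =>
    continuous_paraboloid.continuousOn.mul (h.continuousOn_comp hs h.contDiffOn.continuousOn)
  have hIoo : Set.Ioo (-(X.2 / 2)) (X.2 / 2) ∈ 𝓝 r := Ioo_mem_nhds (abs_lt.1 hr).1 (abs_lt.1 hr).2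
  refine (hasDerivAt_integral_of_dominated_loc_of_deriv_le (bound := fun _ => C)
    (F := fun s y => paraboloid y * U (X + s • y))
    (F' := fun s y => paraboloid y * fderiv ℝ U (X + s • y) y) hIoo ?_ ?_ ?_ ?_ ?_ ?_).2
  · filter_upwards [hIoo] with s hs
    exact (hcU s (abs_le.2 ⟨hs.1.le, hs.2.le⟩)).aestronglyMeasurable measurableSet_unitBall
  · exact (hcU r hr.le).integrableOn_compact isCompact_unitBall
  · exact (hcont.comp (f := fun y : Pt n => (r, y)) (by fun_prop) fun y hy =>
      ⟨abs_le.1 hr.le, hy⟩).aestronglyMeasurable measurableSet_unitBall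
  · filter_upwards [ae_restrict_mem measurableSet_unitBall] with y hy s hs
    exact hC (s, y) ⟨⟨hs.1.le, hs.2.le⟩, hy⟩
  · exact continuousOn_const.integrableOn_compact isCompact_unitBall
  · filter_upwards [ae_restrict_mem measurableSet_unitBall] with y hy s hs
    have h1 : HasDerivAt (fun s : ℝ => X + s • y) y s := by
      simpa using ((hasDerivAt_id s).smul_const y).const_add X
    exact ((h.differentiableAt
      (h.mem s (abs_le.2 ⟨hs.1.le, hs.2.le⟩) y hy)).hasFDerivAt.comp_hasDerivAt s h1).const_mul _

lemma setIntegral_second_deriv (h : InteriorSol a U O X) (hr : |r| ≤ X.2 / 2) (v : Pt n) :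
    4 * ∫ y in unitBall n, paraboloid y * (⟪y.1, v.1⟫ + y.2 * v.2) * fderiv ℝ U (X + r • y) v =
      ∫ y in unitBall n, paraboloid y ^ 2 * (r * d2 U (X + r • y) v) := by
  have hv := h.contDiffOn_fderiv_apply v
  refine (setIntegral_sq_paraboloid_mul (h.continuousOn_comp hr hv.continuousOn) ?_ ?_).symm
  · exact continuousOn_const.mul (h.continuousOn_comp hr
      ((hv.continuousOn_fderiv_of_isOpen h.isOpen le_rfl).clm_apply continuousOn_const))
  · intro y hy
    exact hasLineDerivAt_comp_affine ((hv.contDiffAt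
      (h.isOpen.mem_nhds (h.mem r hr y hy))).differentiableAt one_ne_zero) v

lemma continuousOn_d2 (h : InteriorSol a U O X) (v : Pt n) :
    ContinuousOn (fun Y => d2 U Y v) O :=
  ((h.contDiffOn_fderiv_apply v).continuousOn_fderiv_of_isOpen h.isOpen le_rfl).clm_apply
    continuousOn_const

lemma setIntegral_radial_deriv (h : InteriorSol a U O X) (hr : |r| ≤ X.2 / 2) :
    4 * ∫ y in unitBall n, paraboloid y * fderiv ℝ U (X + r • y) y =
      ∫ y in unitBall n, paraboloid y ^ 2 * (r * lapl U (X + r • y)) := by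
  have hχ : ContinuousOn (paraboloid : Pt n → ℝ) (unitBall n) := continuous_paraboloid.continuousOn
  have hi1 : ∀ v : Pt n, IntegrableOn (fun y => paraboloid y * (⟪y.1, v.1⟫ + y.2 * v.2) *
      fderiv ℝ U (X + r • y) v) (unitBall n) := fun v =>
    ((hχ.mul (by fun_prop)).mul (h.continuousOn_comp hr
      (h.contDiffOn_fderiv_apply v).continuousOn)).integrableOn_compact isCompact_unitBall
  have hi2 : ∀ v : Pt n, IntegrableOn (fun y => paraboloid y ^ 2 * (r * d2 U (X + r • y) v))
      (unitBall n) := fun v =>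
    ((hχ.pow 2).mul (continuousOn_const.mul
      (h.continuousOn_comp hr (h.continuousOn_d2 v)))).integrableOn_compact isCompact_unitBall
  calc _ = 4 * ∫ y in unitBall n, ((∑ i : Fin n, paraboloid y *
          (⟪y.1, ((EuclideanSpace.single i (1 : ℝ), (0 : ℝ)) : Pt n).1⟫ +
            y.2 * ((EuclideanSpace.single i (1 : ℝ), (0 : ℝ)) : Pt n).2) *
            fderiv ℝ U (X + r • y) (EuclideanSpace.single i (1 : ℝ), (0 : ℝ))) +
          paraboloid y * (⟪y.1, ((0, 1) : Pt n).1⟫ + y.2 * ((0, 1) : Pt n).2) *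
            fderiv ℝ U (X + r • y) (0, 1)) := by
        congr 2 with y
        rw [sum_coord _ y, mul_add, Finset.mul_sum]
        congr 1
        · refine Finset.sum_congr rfl fun i _ => ?_
          rw [EuclideanSpace.inner_single_right]
          simp [mul_assoc]
        · simp [mul_assoc]
    _ = ∫ y in unitBall n, ((∑ i : Fin n, paraboloid y ^ 2 *
          (r * d2 U (X + r • y) (EuclideanSpace.single i (1 : ℝ), (0 : ℝ)))) +
          paraboloid y ^ 2 * (r * d2 U (X + r • y) (0, 1))) := by
        rw [integral_add (integrable_finsetSum _ fun i _ => hi1 (EuclideanSpace.single i 1, 0))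
            (hi1 (0, 1)), integral_finsetSum _ fun i _ => hi1 (EuclideanSpace.single i 1, 0),
          integral_add (integrable_finsetSum _ fun i _ => hi2 (EuclideanSpace.single i 1, 0))
            (hi2 (0, 1)), integral_finsetSum _ fun i _ => hi2 (EuclideanSpace.single i 1, 0),
          mul_add, Finset.mul_sum]
        congr 1
        · exact Finset.sum_congr rfl fun i _ => h.setIntegral_second_deriv hr _
        · exact h.setIntegral_second_deriv hr (0, 1)
    _ = _ := by
        congr 1 with y
        rw [lapl, mul_add, mul_add, Finset.mul_sum, Finset.mul_sum]

lemma setIntegral_vertical_deriv (h : InteriorSol a U O X) (hr : |r| ≤ X.2 / 2) :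
    ∫ y in unitBall n, paraboloid y ^ 2 * (r * (dt U (X + r • y) / (X + r • y).2)) =
      ∫ y in unitBall n, (4 * (paraboloid y * y.2) / (X + r • y).2 +
        r * paraboloid y ^ 2 / (X + r • y).2 ^ 2) * U (X + r • y) := by
  have hχ : ContinuousOn (paraboloid : Pt n → ℝ) (unitBall n) := continuous_paraboloid.continuousOn
  have ht0 : ∀ y ∈ unitBall n, (X + r • y).2 ≠ 0 := fun y hy =>
    (lt_of_lt_of_le (by linarith [h.pos]) (half_le_snd hr hy)).ne'
  have ht : ContinuousOn (fun y : Pt n => (X + r • y).2) (unitBall n) := by fun_prop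
  have hU := h.continuousOn_comp hr h.contDiffOn.continuousOn
  have hD := h.continuousOn_comp hr (h.contDiffOn_fderiv_apply (0, 1)).continuousOn
  have hg' : ContinuousOn (fun y => r * (dt U (X + r • y) / (X + r • y).2) -
      r * (U (X + r • y) / (X + r • y).2 ^ 2)) (unitBall n) :=
    (continuousOn_const.mul (hD.div ht ht0)).sub
      (continuousOn_const.mul (hU.div (ht.pow 2) fun y hy => pow_ne_zero 2 (ht0 y hy)))
  have key := setIntegral_sq_paraboloid_mul (v := ((0, 1) : Pt n)) (hU.div ht ht0) hg' (by
    intro y hy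
    have h1 := hasLineDerivAt_comp_affine (h.differentiableAt (h.mem r hr y hy)) (0, 1)
    have h2 : HasDerivAt (fun s : ℝ => (X + r • (y + s • ((0, 1) : Pt n))).2) r 0 := by
      have := (((hasDerivAt_id (0 : ℝ)).const_add y.2).const_mul r).const_add X.2
      rw [mul_one] at this
      exact this.congr_of_eventuallyEq (Eventually.of_forall fun s => by simp [mul_add])
    have h3 := HasDerivAt.div h1 h2 (by simpa using ht0 y hy)
    refine h3.congr_deriv ?_
    have := ht0 y hy
    simp only [zero_smul, add_zero, dt]
    field_simp)
  have e : ∫ y in unitBall n, paraboloid y ^ 2 * (r * (dt U (X + r • y) / (X + r • y).2)) =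
      (∫ y in unitBall n, paraboloid y ^ 2 * (r * (dt U (X + r • y) / (X + r • y).2) -
        r * (U (X + r • y) / (X + r • y).2 ^ 2))) +
      ∫ y in unitBall n, paraboloid y ^ 2 * (r * (U (X + r • y) / (X + r • y).2 ^ 2)) := by
    rw [← integral_add]
    · congr 1 with y; ring
    · exact ((hχ.pow 2).mul hg').integrableOn_compact isCompact_unitBall
    · exact ((hχ.pow 2).mul (continuousOn_const.mul (hU.div (ht.pow 2) fun y hy =>
        pow_ne_zero 2 (ht0 y hy)))).integrableOn_compact isCompact_unitBall
  rw [e, key, ← integral_const_mul, ← integral_add]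
  · congr 1 with y
    simp only [Pi.div_apply, inner_zero_right]
    ring
  · exact (continuousOn_const.mul ((hχ.mul (by fun_prop)).mul (hU.div ht ht0))).integrableOn_compact
      isCompact_unitBall
  · exact ((hχ.pow 2).mul (continuousOn_const.mul (hU.div (ht.pow 2) fun y hy =>
        pow_ne_zero 2 (ht0 y hy)))).integrableOn_compact isCompact_unitBall

lemma wmean_nonneg (h : InteriorSol a U O X) (hr : |r| ≤ X.2 / 2) : 0 ≤ wmean U X r :=
  setIntegral_nonneg measurableSet_unitBall fun y hy =>
    mul_nonneg (paraboloid_nonneg y) (h.nonneg _ (h.mem r hr y hy))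

lemma integrableOn_wmean (h : InteriorSol a U O X) (hr : |r| ≤ X.2 / 2) :
    IntegrableOn (fun y => paraboloid y * U (X + r • y)) (unitBall n) :=
  (continuous_paraboloid.continuousOn.mul
    (h.continuousOn_comp hr h.contDiffOn.continuousOn)).integrableOn_compact isCompact_unitBall

lemma abs_deriv_wmean_le (h : InteriorSol a U O X) (ha : |a| ≤ 1) (hr : |r| < X.2 / 2) :
    |∫ y in unitBall n, paraboloid y * fderiv ℝ U (X + r • y) y| ≤
      5 / 2 / X.2 * wmean U X r := by
  have hX := h.pos
  have e : ∫ y in unitBall n, paraboloid y ^ 2 * (r * lapl U (X + r • y)) =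
      -a * ∫ y in unitBall n, paraboloid y ^ 2 * (r * (dt U (X + r • y) / (X + r • y).2)) := by
    rw [← integral_const_mul]
    refine setIntegral_congr_fun measurableSet_unitBall fun y hy => ?_
    have := h.eq _ (h.mem r hr.le y hy)
    have : lapl U (X + r • y) = -(a / (X + r • y).2 * dt U (X + r • y)) := by linarith
    simp only [this]
    ring
  have h1 := h.setIntegral_radial_deriv hr.le
  rw [e, h.setIntegral_vertical_deriv hr.le] at h1
  have h2 : |∫ y in unitBall n, (4 * (paraboloid y * y.2) / (X + r • y).2 +
        r * paraboloid y ^ 2 / (X + r • y).2 ^ 2) * U (X + r • y)| ≤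
      ∫ y in unitBall n, 10 / X.2 * (paraboloid y * U (X + r • y)) := by
    rw [← Real.norm_eq_abs]
    refine norm_integral_le_of_norm_le ((h.integrableOn_wmean hr.le).const_mul _) ?_
    filter_upwards [ae_restrict_mem measurableSet_unitBall] with y hy
    have hU := h.nonneg _ (h.mem r hr.le y hy)
    have hχ := paraboloid_nonneg y
    have ht := half_le_snd hr.le hy
    set t := (X + r • y).2 with ht'
    have ht0 : 0 < t := by linarith
    rw [Real.norm_eq_abs, abs_mul, abs_of_nonneg hU, ← mul_assoc (10 / X.2)]
    refine mul_le_mul_of_nonneg_right ?_ hU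
    have i1 : |4 * (paraboloid y * y.2) / t| ≤ 8 / X.2 * paraboloid y := by
      rw [abs_div, abs_of_pos ht0, abs_mul, abs_mul, abs_of_nonneg hχ,
        abs_of_pos (by norm_num : (0 : ℝ) < 4), div_le_iff₀ ht0]
      calc 4 * (paraboloid y * |y.2|) ≤ 4 * (paraboloid y * 1) := by
            gcongr; exact abs_snd_le_one hy
        _ = 8 / X.2 * paraboloid y * (X.2 / 2) := by field_simp; ring
        _ ≤ _ := by gcongr
    have i2 : |r * paraboloid y ^ 2 / t ^ 2| ≤ 2 / X.2 * paraboloid y := by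
      rw [abs_div, abs_of_pos (pow_pos ht0 2), abs_mul, abs_of_nonneg (sq_nonneg (paraboloid y)),
        div_le_iff₀ (pow_pos ht0 2)]
      calc |r| * paraboloid y ^ 2 ≤ X.2 / 2 * (paraboloid y * 1) := by
            rw [sq]; gcongr; exact paraboloid_le_one y
        _ = 2 / X.2 * paraboloid y * (X.2 / 2) ^ 2 := by field_simp
        _ ≤ _ := by gcongr
    calc _ ≤ _ := abs_add_le _ _
      _ ≤ 8 / X.2 * paraboloid y + 2 / X.2 * paraboloid y := add_le_add i1 i2
      _ = _ := by ring
  rw [integral_const_mul] at h2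
  have h3 : 4 * |∫ y in unitBall n, paraboloid y * fderiv ℝ U (X + r • y) y| ≤
      1 * (10 / X.2 * wmean U X r) := by
    rw [← abs_of_pos (by norm_num : (0 : ℝ) < 4), ← abs_mul, h1, abs_mul, abs_neg]
    exact mul_le_mul ha h2 (abs_nonneg _) zero_le_one
  calc _ ≤ (10 / X.2 * wmean U X r) / 4 := by linarith
    _ = _ := by ring

end InteriorSol

end Harnack

section Comparison

variable {n : ℕ} {U : Pt n → ℝ} {a : ℝ} {O : Set (Pt n)} {X X₀ : Pt n} {r : ℝ}

lemma le_exp_mul_of_deriv_le {f f' : ℝ → ℝ} {K b : ℝ} (hb : 0 ≤ b)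
    (hf : ∀ s ∈ Set.Icc 0 b, HasDerivAt f (f' s) s) (hle : ∀ s ∈ Set.Icc 0 b, f' s ≤ K * f s) :
    f b ≤ Real.exp (K * b) * f 0 := by
  have hd : ∀ s ∈ Set.Icc 0 b, HasDerivAt (fun s => Real.exp (-K * s) * f s)
      (Real.exp (-K * s) * (f' s - K * f s)) s := by
    intro s hs
    have h1 : HasDerivAt (fun s : ℝ => Real.exp (-K * s)) (Real.exp (-K * s) * -K) s := by
      simpa using ((hasDerivAt_id s).const_mul (-K)).exp
    exact (h1.mul (hf s hs)).congr_deriv (by ring)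
  have hanti : AntitoneOn (fun s => Real.exp (-K * s) * f s) (Set.Icc 0 b) := by
    refine antitoneOn_of_deriv_nonpos (convex_Icc 0 b)
      (fun s hs => (hd s hs).continuousAt.continuousWithinAt)
      (fun s hs => (hd s (interior_subset hs)).differentiableAt.differentiableWithinAt)
      fun s hs => ?_
    rw [(hd s (interior_subset hs)).deriv]
    exact mul_nonpos_of_nonneg_of_nonpos (Real.exp_nonneg _)
      (sub_nonpos.2 (hle s (interior_subset hs)))
  have := hanti (Set.left_mem_Icc.2 hb) (Set.right_mem_Icc.2 hb) hb
  simp only [mul_zero, Real.exp_zero, one_mul] at this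
  calc f b = Real.exp (K * b) * (Real.exp (-K * b) * f b) := by
        rw [← mul_assoc, ← Real.exp_add]; simp
    _ ≤ _ := by gcongr

lemma wmean_zero (U : Pt n → ℝ) (X : Pt n) :
    wmean U X 0 = U X * ∫ y in unitBall n, paraboloid y := by
  simp [wmean, ← integral_const_mul, mul_comm]

lemma InteriorSol.wmean_comparable (h : InteriorSol a U O X) (ha : |a| ≤ 1) (hr0 : 0 ≤ r)
    (hr : r < X.2 / 2) :
    wmean U X r ≤ Real.exp (5 / 4) * wmean U X 0 ∧
      wmean U X 0 ≤ Real.exp (5 / 4) * wmean U X r := by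
  have hX := h.pos
  have habs : ∀ s ∈ Set.Icc 0 r, |s| < X.2 / 2 := fun s hs => by
    rw [abs_of_nonneg hs.1]; exact hs.2.trans_lt hr
  have hle := fun s hs => abs_le.1 (h.abs_deriv_wmean_le ha (habs s hs))
  have hK : 5 / 2 / X.2 * r ≤ 5 / 4 := by
    calc 5 / 2 / X.2 * r ≤ 5 / 2 / X.2 * (X.2 / 2) := by gcongr
      _ = 5 / 4 := by field_simp; norm_num
  have hexp := Real.exp_le_exp.2 hK
  constructor
  · refine (le_exp_mul_of_deriv_le hr0 (fun s hs => h.hasDerivAt_wmean (habs s hs))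
      fun s hs => (hle s hs).2).trans ?_
    exact mul_le_mul_of_nonneg_right hexp (h.wmean_nonneg (by simp; positivity))
  · have h1 := le_exp_mul_of_deriv_le (K := -(5 / 2 / X.2)) hr0
      (fun s hs => (h.hasDerivAt_wmean (habs s hs)).neg)
      fun s hs => by
        have := (hle s hs).1
        simp only [Pi.neg_apply]
        linarith
    simp only [Pi.neg_apply, neg_mul, mul_neg, neg_le_neg_iff] at h1
    calc wmean U X 0 = Real.exp (5 / 2 / X.2 * r) *
          (Real.exp (-(5 / 2 / X.2 * r)) * wmean U X 0) := by
          rw [← mul_assoc, ← Real.exp_add]; simp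
      _ ≤ Real.exp (5 / 2 / X.2 * r) * wmean U X r := by gcongr
      _ ≤ _ := mul_le_mul_of_nonneg_right hexp
          (h.wmean_nonneg (by rw [abs_of_nonneg hr0]; exact hr.le))

lemma sqn_add_le (X Y : Pt n) : sqn (X + Y) ≤ 2 * sqn X + 2 * sqn Y := by
  have h1 := norm_add_le X.1 Y.1
  have h2 : ‖X.1 + Y.1‖ ^ 2 ≤ (‖X.1‖ + ‖Y.1‖) ^ 2 := by gcongr
  unfold sqn
  simp only [Prod.fst_add, Prod.snd_add]
  nlinarith [sq_nonneg (‖X.1‖ - ‖Y.1‖), sq_nonneg (X.2 - Y.2)]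

lemma sqn_smul (c : ℝ) (X : Pt n) : sqn (c • X) = c ^ 2 * sqn X := by
  simp [sqn, norm_smul, mul_pow, mul_add]

/-- The constant in the interior Harnack inequality. -/
def harnackConst (n : ℕ) : ℝ :=
  Real.exp (5 / 4) ^ 2 * (9 / 5 * |(((1 : ℝ) / 3) ^ Module.finrank ℝ (Pt n))⁻¹|)

lemma harnackConst_pos : 0 < harnackConst n := by unfold harnackConst; positivity

lemma wmean_le_wmean (h : InteriorSol a U O X) (hρ : 0 < r) (hr : 3 * r ≤ X.2 / 2)
    (hX : sqn (X₀ - X) ≤ r ^ 2) :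
    wmean U X₀ r ≤
      9 / 5 * |(((1 : ℝ) / 3) ^ Module.finrank ℝ (Pt n))⁻¹| * wmean U X (3 * r) := by
  have habs : |3 * r| ≤ X.2 / 2 := by rwa [abs_of_pos (by positivity)]
  set F : Pt n → ℝ := fun z => paraboloid z * U (X + (3 * r) • z) with hF
  have hF0 : ∀ z ∉ unitBall n, F z = 0 := fun z hz => by simp [hF, paraboloid_eq_zero hz]
  have hFnn : ∀ z, 0 ≤ F z := by
    intro z
    by_cases hz : z ∈ unitBall n
    · exact mul_nonneg (paraboloid_nonneg z) (h.nonneg _ (h.mem _ habs z hz))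
    · exact (hF0 z hz).ge
  have hFi : Integrable F := (h.integrableOn_wmean habs).integrable_of_forall_notMem_eq_zero hF0
  set w : Pt n := (3 * r)⁻¹ • (X₀ - X) with hw
  have hw9 : sqn w ≤ 1 / 9 := by
    rw [hw, sqn_smul]
    calc _ ≤ ((3 * r)⁻¹) ^ 2 * r ^ 2 := by gcongr
      _ = 1 / 9 := by field_simp; norm_num
  have hGi : Integrable fun y : Pt n => 9 / 5 * F (w + ((1 : ℝ) / 3) • y) :=
    ((hFi.comp_add_left w).comp_smul (by norm_num)).const_mul _
  have hpt : ∀ y ∈ unitBall n, 0 ≤ paraboloid y * U (X₀ + r • y) ∧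
      paraboloid y * U (X₀ + r • y) ≤ 9 / 5 * F (w + ((1 : ℝ) / 3) • y) := by
    intro y hy
    have h4 : sqn (w + ((1 : ℝ) / 3) • y) ≤ 4 / 9 := by
      have h1 := sqn_add_le w (((1 : ℝ) / 3) • y)
      have h2 : sqn y ≤ 1 := hy
      rw [sqn_smul ((1 : ℝ) / 3)] at h1
      linarith
    have hmem : w + ((1 : ℝ) / 3) • y ∈ unitBall n := by
      change sqn _ ≤ 1; linarith
    have hpar : 5 / 9 ≤ paraboloid (w + ((1 : ℝ) / 3) • y) :=
      le_max_of_le_left (by linarith)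
    have hz : X + (3 * r) • (w + ((1 : ℝ) / 3) • y) = X₀ + r • y := by
      rw [smul_add, hw, smul_smul, smul_smul, mul_inv_cancel₀ (by positivity)]
      have : 3 * r * (1 / 3) = r := by ring
      rw [this, one_smul]; abel
    have hU : 0 ≤ U (X₀ + r • y) := hz ▸ h.nonneg _ (h.mem _ habs _ hmem)
    refine ⟨mul_nonneg (paraboloid_nonneg y) hU, ?_⟩
    simp only [hF, hz]
    rw [← mul_assoc]
    refine mul_le_mul_of_nonneg_right ?_ hU
    linarith [paraboloid_le_one y]
  calc wmean U X₀ r ≤ ∫ y in unitBall n, 9 / 5 * F (w + ((1 : ℝ) / 3) • y) := by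
        refine integral_mono_of_nonneg ?_ hGi.integrableOn ?_
        · filter_upwards [ae_restrict_mem measurableSet_unitBall] with y hy using (hpt y hy).1
        · filter_upwards [ae_restrict_mem measurableSet_unitBall] with y hy using (hpt y hy).2
    _ ≤ ∫ y, 9 / 5 * F (w + ((1 : ℝ) / 3) • y) :=
        setIntegral_le_integral hGi (Eventually.of_forall fun y => by
          have := hFnn (w + ((1 : ℝ) / 3) • y)
          simp only [Pi.zero_apply]; positivity)
    _ = _ := by
        rw [integral_const_mul, Measure.integral_comp_smul volume (fun z => F (w + z)),
          integral_add_left_eq_self F w, wmean,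
          setIntegral_eq_integral_of_forall_compl_eq_zero hF0, smul_eq_mul, mul_assoc]

/-- Interior Harnack inequality. -/
theorem harnack (h₀ : InteriorSol a U O X₀) (h : InteriorSol a U O X) (ha : |a| ≤ 1)
    (hX : sqn (X₀ - X) ≤ (X₀.2 / 8) ^ 2) : U X₀ ≤ harnackConst n * U X := by
  have ht₀ := h₀.pos
  have hI := integral_paraboloid_pos (n := n)
  have ht : |X₀.2 - X.2| ≤ X₀.2 / 8 := by
    refine abs_le_of_sq_le_sq ?_ (by positivity)
    unfold sqn at hX
    simp only [Prod.snd_sub] at hX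
    linarith [sq_nonneg ‖(X₀ - X).1‖]
  have ht' := (abs_le.1 ht).2
  have h1 := (h₀.wmean_comparable (r := X₀.2 / 8) ha (by positivity) (by linarith)).2
  have h2 := wmean_le_wmean h (r := X₀.2 / 8) (by positivity) (by linarith) hX
  have h3 := (h.wmean_comparable (r := 3 * (X₀.2 / 8)) ha (by positivity) (by linarith)).1
  rw [wmean_zero] at h1 h3
  refine le_of_mul_le_mul_right ?_ hI
  calc _ ≤ _ := h1
    _ ≤ Real.exp (5 / 4) * (9 / 5 * |(((1 : ℝ) / 3) ^ Module.finrank ℝ (Pt n))⁻¹| *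
        (Real.exp (5 / 4) * (U X * ∫ y in unitBall n, paraboloid y))) := by
        gcongr
        exact h2.trans (by gcongr)
    _ = _ := by unfold harnackConst; ring

lemma ExtSol.interiorSol {σ : ℝ} (hU : ExtSol n σ 2 U) (hX : sqn X ≤ 1) (ht : 0 < X.2) :
    InteriorSol (1 - 2 * σ) U {X : Pt n | enorm' X < 2 ∧ 0 < X.2} X where
  isOpen := isOpen_halfBall 2
  contDiffOn := hU.2.2.1
  nonneg Y hY := hU.1 Y hY.1.le hY.2.le fun h => by simpa [h] using hY.2
  eq Y hY := hU.2.2.2.1 Y hY.1 hY.2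
  pos := ht
  mem r hr y hy := by
    refine ⟨enorm'_lt_of_sqn_lt (by norm_num) ?_, (half_pos ht).trans_le (half_le_snd hr hy)⟩
    have h1 := sqn_add_le X (r • y)
    have h2 : sqn y ≤ 1 := hy
    have h3 : X.2 ^ 2 ≤ 1 := by unfold sqn at hX; linarith [sq_nonneg ‖X.1‖]
    have h4 : r ^ 2 ≤ (X.2 / 2) ^ 2 := sq_le_sq' (abs_le.1 hr).1 (abs_le.1 hr).2
    have h5 : r ^ 2 * sqn y ≤ r ^ 2 := mul_le_of_le_one_right (sq_nonneg r) h2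
    rw [sqn_smul] at h1
    linarith

end Comparison

section Upper

variable {n : ℕ} {σ : ℝ} {U : Pt n → ℝ} {X₀ : Pt n}

/-- Sublevel sets of this function are neighbourhoods of `X₀` reaching the boundary `t = 0`. -/
def well (ε : ℝ) (X₀ Y : Pt n) : ℝ :=
  ε / X₀.2 ^ 2 * ‖Y.1 - X₀.1‖ ^ 2 + ((Y.2 / X₀.2) ^ 2 - 1) ^ 2

lemma continuous_well (ε : ℝ) (X₀ : Pt n) : Continuous (well ε X₀) := by
  unfold well; fun_prop

lemma well_nonneg {ε : ℝ} (hε : 0 ≤ ε) (X₀ Y : Pt n) : 0 ≤ well ε X₀ Y := by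
  unfold well; positivity

lemma hasDerivAt_exp_neg_sub (m c y : ℝ) :
    HasDerivAt (fun y => Real.exp (-m * y) - c) (-m * Real.exp (-m * y)) y := by
  have := (((hasDerivAt_id y).const_mul (-m)).exp).sub_const c
  exact this.congr_deriv (by simp; ring)

lemma hasDerivAt_well_profile (t₀ t : ℝ) :
    HasDerivAt (fun t : ℝ => ((t / t₀) ^ 2 - 1) ^ 2)
      (t * (4 / t₀ ^ 2 * ((t / t₀) ^ 2 - 1))) t := by
  have := ((((hasDerivAt_id t).div_const t₀).pow 2).sub_const 1).pow 2
  refine this.congr_deriv ?_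
  simp only [id, Nat.cast_ofNat, Pi.pow_apply]
  ring

lemma hasL_exp_well (hn : n ≠ 0) (m c : ℝ) (ht₀ : 0 < X₀.2) {Y : Pt n} (hY : 0 < Y.2) :
    HasL σ (fun Y => Real.exp (-m * well ((2 - 2 * σ) / n) X₀ Y) - c) Y
      (m * Real.exp (-m * well ((2 - 2 * σ) / n) X₀ Y) / X₀.2 ^ 2 *
        (m * (4 * ((2 - 2 * σ) / n) ^ 2 * (‖Y.1 - X₀.1‖ ^ 2 / X₀.2 ^ 2) +
            16 * (Y.2 / X₀.2) ^ 2 * ((Y.2 / X₀.2) ^ 2 - 1) ^ 2) -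
          ((16 - 8 * σ) * (Y.2 / X₀.2) ^ 2 - (4 - 4 * σ)))) := by
  have h2 : HasDerivAt (fun t : ℝ => t * (4 / X₀.2 ^ 2 * ((t / X₀.2) ^ 2 - 1)))
      (4 / X₀.2 ^ 2 * (3 * (Y.2 / X₀.2) ^ 2 - 1)) Y.2 := by
    have := (hasDerivAt_id Y.2).mul
      (((((hasDerivAt_id Y.2).div_const X₀.2).pow 2).sub_const 1).const_mul (4 / X₀.2 ^ 2))
    refine this.congr_deriv ?_
    simp only [id, Nat.cast_ofNat, Pi.pow_apply]
    ring
  have h := hasL_comp (σ := σ) (X := Y) X₀.1 ((2 - 2 * σ) / n / X₀.2 ^ 2)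
    (G' := fun y => -m * Real.exp (-m * y))
    (Eventually.of_forall fun t => hasDerivAt_well_profile X₀.2 t) h2
    (Eventually.of_forall fun y => hasDerivAt_exp_neg_sub m c y)
    (((hasDerivAt_exp_neg_sub m 0 _).congr_of_eventuallyEq
      (Eventually.of_forall fun y => (sub_zero _).symm)).const_mul (-m))
  convert! h using 1
  have hn' : (n : ℝ) ≠ 0 := by exact_mod_cast hn
  unfold well
  have := ht₀.ne'
  have := hY.ne'
  field_simp
  ring

lemma hasFlux_exp_well (hσ : σ < 1) (ε m c : ℝ) (X₀ : Pt n) (x : EuclideanSpace ℝ (Fin n)) :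
    HasFlux σ (fun Y => Real.exp (-m * well ε X₀ Y) - c) x 0 :=
  hasFlux_comp hσ X₀.1 (ε / X₀.2 ^ 2) (fun t => hasDerivAt_well_profile X₀.2 t) (by fun_prop)
    (Eventually.of_forall fun y => hasDerivAt_exp_neg_sub m c y) (by fun_prop)

/-- For large `m` the function `exp (-m * well)` is a subsolution away from `X₀`. -/
lemma exists_well_exponent (hσ : σ ∈ Set.Ioo (0 : ℝ) 1) {ε : ℝ} (hε : 0 < ε) {Λ : ℝ} (hΛ : 0 < Λ) :
    ∃ m > 0, ∀ p s : ℝ, 0 ≤ p → 0 ≤ s → ε * p + (s ^ 2 - 1) ^ 2 ≤ Λ →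
      1 / 64 ≤ p + (s - 1) ^ 2 →
      (16 - 8 * σ) * s ^ 2 - (4 - 4 * σ) ≤
        m * (4 * ε ^ 2 * p + 16 * s ^ 2 * (s ^ 2 - 1) ^ 2) := by
  obtain ⟨hσ0, hσ1⟩ := hσ
  set μ : ℝ := min (4 * ε ^ 2) (4 * (1 - σ)) with hμ
  have hμ0 : 0 < μ := lt_min (by positivity) (by linarith)
  refine ⟨16 * (2 + Λ) * (64 / μ), by positivity, fun p s hp hs hle hfar => ?_⟩
  have hq : s ^ 2 ≤ 2 + Λ := by
    have : 0 ≤ ε * p := by positivity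
    nlinarith [sq_nonneg (s ^ 2 - 1 - 1 / 2)]
  rcases le_total (s ^ 2) ((1 - σ) / 4) with h | h
  · have h1 : (16 - 8 * σ) * s ^ 2 ≤ (16 - 8 * σ) * ((1 - σ) / 4) :=
      mul_le_mul_of_nonneg_left h (by linarith)
    have h2 : 0 ≤ 16 * (2 + Λ) * (64 / μ) *
        (4 * ε ^ 2 * p + 16 * s ^ 2 * (s ^ 2 - 1) ^ 2) := by positivity
    nlinarith
  · have h1 : (s - 1) ^ 2 ≤ (s ^ 2 - 1) ^ 2 := by
      have : (s ^ 2 - 1) ^ 2 = (s - 1) ^ 2 * (s + 1) ^ 2 := by ring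
      rw [this]
      exact le_mul_of_one_le_right (sq_nonneg _) (one_le_pow₀ (by linarith))
    have h2 : μ * p ≤ 4 * ε ^ 2 * p := mul_le_mul_of_nonneg_right (min_le_left _ _) hp
    have h3 : μ * (s - 1) ^ 2 ≤ 16 * s ^ 2 * (s ^ 2 - 1) ^ 2 :=
      mul_le_mul ((min_le_right _ _).trans (by linarith)) h1 (sq_nonneg _) (by positivity)
    have h4 : μ / 64 ≤ 4 * ε ^ 2 * p + 16 * s ^ 2 * (s ^ 2 - 1) ^ 2 := by
      have := mul_le_mul_of_nonneg_left hfar hμ0.le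
      linarith
    calc (16 - 8 * σ) * s ^ 2 - (4 - 4 * σ) ≤ 16 * (2 + Λ) := by nlinarith
      _ = 16 * (2 + Λ) * (64 / μ) * (μ / 64) := by field_simp
      _ ≤ _ := by gcongr

theorem barrier_le (hσ : σ ∈ Set.Ioo (0 : ℝ) 1) (hn : 2 ≤ n) (hU : ExtSol n σ 2 U)
    (hpos : ∀ x : EuclideanSpace ℝ (Fin n), x ≠ 0 → ‖x‖ < 1 → 0 < U (x, 0)) {m Λ : ℝ}
    (hm : 0 < m)
    (hbar : ∀ p s : ℝ, 0 ≤ p → 0 ≤ s → (2 - 2 * σ) / n * p + (s ^ 2 - 1) ^ 2 ≤ Λ →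
      1 / 64 ≤ p + (s - 1) ^ 2 →
      (16 - 8 * σ) * s ^ 2 - (4 - 4 * σ) ≤
        m * (4 * ((2 - 2 * σ) / n) ^ 2 * p + 16 * s ^ 2 * (s ^ 2 - 1) ^ 2))
    (ht₀ : 0 < X₀.2) (hX₀ : sqn X₀ ≤ 1)
    (hsmall : ∀ Y, well ((2 - 2 * σ) / n) X₀ Y ≤ Λ → sqn Y < 1)
    {X : Pt n} (ht : 0 ≤ X.2) (hX0 : 0 < sqn X) (hX : well ((2 - 2 * σ) / n) X₀ X ≤ Λ) :
    U X₀ / harnackConst n *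
      (Real.exp (-m * well ((2 - 2 * σ) / n) X₀ X) - Real.exp (-m * Λ)) ≤ U X := by
  obtain ⟨hσ0, hσ1⟩ := hσ
  have hn' : (2 : ℝ) ≤ n := by exact_mod_cast hn
  have hCH := harnackConst_pos (n := n)
  have hε : 0 ≤ (2 - 2 * σ) / n := div_nonneg (by linarith) (by linarith)
  set k : ℝ := (n - 2 * σ) / 4 with hk
  have hkpos : 0 < k := by rw [hk]; linarith
  set M : ℝ := U X₀ / harnackConst n with hM
  have hX₀0 : 0 < sqn X₀ := by
    unfold sqn; positivity
  have hM0 : 0 ≤ M := div_nonneg (hU.nonneg hX₀0 (by linarith) ht₀.le) hCH.le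
  set φ : Pt n → ℝ :=
    fun Y => Real.exp (-m * well ((2 - 2 * σ) / n) X₀ Y) - Real.exp (-m * Λ) with hφ
  have hwc := continuous_well ((2 - 2 * σ) / n) X₀
  have hφc : Continuous φ := by fun_prop
  have hφ1 : ∀ Y, φ Y ≤ 1 := by
    intro Y
    have h1 : Real.exp (-m * well ((2 - 2 * σ) / n) X₀ Y) ≤ 1 := by
      rw [Real.exp_le_one_iff, neg_mul]
      exact neg_nonpos.2 (mul_nonneg hm.le (well_nonneg hε X₀ Y))
    have h2 := Real.exp_pos (-m * Λ)
    simp only [hφ]; linarith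
  have hharn : ∀ Y : Pt n, sqn Y ≤ 1 → 0 < Y.2 → sqn (X₀ - Y) ≤ (X₀.2 / 8) ^ 2 → M ≤ U Y := by
    intro Y hY1 hYt hY
    rw [hM, div_le_iff₀' hCH]
    exact harnack (hU.interiorSol hX₀ ht₀) (hU.interiorSol hY1 hYt)
      (abs_le.2 ⟨by linarith, by linarith⟩) hY
  have key : ∀ η : ℝ, 0 < η → M * φ X ≤ U X + η * sqn X ^ (-k) := by
    intro η hη
    obtain ⟨τ, hτ0, hτX, hτ⟩ := exists_rpow_neg_ge hkpos M hη hX0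
    set K : Set (Pt n) := {Y | τ ≤ sqn Y ∧ well ((2 - 2 * σ) / n) X₀ Y ≤ Λ ∧ 0 ≤ Y.2} with hK
    have hKc : IsClosed K :=
      (isClosed_le continuous_const continuous_sqn).inter
        ((isClosed_le hwc continuous_const).inter
          (isClosed_le continuous_const continuous_snd))
    have hWc : ContinuousOn (fun Y => U Y + η * sqn Y ^ (-k) + -M * φ Y) K :=
      ((hU.continuousOn fun Y hY => ⟨hτ0.trans_le hY.1, by linarith [hsmall Y hY.2.1], hY.2.2⟩).add
        ((continuousOn_sqn_rpow k fun Y hY => hτ0.trans_le hY.1).const_smul η)).add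
        (hφc.continuousOn.const_smul (-M))
    have hmain := nonneg_of_strict_supersolution (σ := σ)
      (isCompact_of_sqn_le hKc zero_le_one fun Y hY => by linarith [hsmall Y hY.2.1])
      hWc ?_ X ⟨hτX, hX, ht⟩
    · linarith
    rintro Y ⟨hYτ, hYΛ, hYt⟩ hneg
    have hY0 : 0 < sqn Y := hτ0.trans_le hYτ
    have hY1 : sqn Y < 1 := hsmall Y hYΛ
    have hUY : 0 ≤ U Y := hU.nonneg hY0 (by linarith) hYt
    have hΓ : 0 < sqn Y ^ (-k) := Real.rpow_pos_of_pos hY0 _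
    have hMφ : M * φ Y ≤ M := mul_le_of_le_one_right hM0 (hφ1 Y)
    have hηΓ : 0 < η * sqn Y ^ (-k) := mul_pos hη hΓ
    have h1 : τ < sqn Y := by
      by_contra! h
      have := hτ _ hY0 h
      linarith
    have h2 : well ((2 - 2 * σ) / n) X₀ Y < Λ := by
      refine lt_of_le_of_ne hYΛ fun h => ?_
      have : φ Y = 0 := by simp only [hφ, h, sub_self]
      rw [this] at hneg
      linarith
    rcases hYt.eq_or_lt with h3 | h3
    · have hY : Y = (Y.1, 0) := Prod.ext rfl h3.symm
      have hYsq : sqn Y = ‖Y.1‖ ^ 2 := by rw [hY]; simp [sqn]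
      have hy0 : Y.1 ≠ 0 := fun h => by rw [hYsq, h] at hY0; simp at hY0
      have hy1 : ‖Y.1‖ < 1 := by
        rw [hYsq] at hY1
        exact (sq_lt_one_iff₀ (norm_nonneg _)).1 hY1
      refine Or.inr ⟨h3.symm, ?_, _, ?_, ((hU.hasFlux (by linarith) hy0).add
        ((hasFlux_sqn_rpow hσ1 k hy0).const_mul η)).add
        ((hasFlux_exp_well hσ1 ((2 - 2 * σ) / n) m (Real.exp (-m * Λ)) X₀ Y.1).const_mul (-M))⟩
      · have hc : Continuous fun s : ℝ => well ((2 - 2 * σ) / n) X₀ (Y.1, s) := by fun_prop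
        have h4 : well ((2 - 2 * σ) / n) X₀ (Y.1, 0) < Λ := by rwa [← hY]
        filter_upwards [nhdsWithin_le_nhds ((hc.tendsto 0).eventually_lt_const h4),
          self_mem_nhdsWithin] with s hs hs0
        refine ⟨?_, hs.le, le_of_lt hs0⟩
        rw [hYsq] at hYτ
        simp only [sqn]
        linarith [sq_nonneg s]
      · have := Real.rpow_pos_of_pos (hpos _ hy0 hy1) ((n + 2 * σ) / (n - 2 * σ))
        linarith
    · refine Or.inl ⟨?_, _, ?_, ((hU.hasL (enorm'_lt_of_sqn_lt (by norm_num) (by linarith)) h3).add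
        ((hasL_sqn_rpow k h3).const_mul η)).add
        ((hasL_exp_well (by omega) m (Real.exp (-m * Λ)) ht₀ h3).const_mul (-M))⟩
      · have ho : IsOpen {Y : Pt n | τ < sqn Y ∧ well ((2 - 2 * σ) / n) X₀ Y < Λ ∧ 0 < Y.2} :=
          (isOpen_lt continuous_const continuous_sqn).inter
            ((isOpen_lt hwc continuous_const).inter
              (isOpen_lt continuous_const continuous_snd))
        filter_upwards [ho.mem_nhds ⟨h1, h2, h3⟩] with Z hZ
        exact ⟨hZ.1.le, hZ.2.1.le, hZ.2.2.le⟩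
      · have hfar : (X₀.2 / 8) ^ 2 < sqn (X₀ - Y) := by
          by_contra! h
          have := hharn Y hY1.le h3 h
          linarith
        have hdist : 1 / 64 ≤ ‖Y.1 - X₀.1‖ ^ 2 / X₀.2 ^ 2 + (Y.2 / X₀.2 - 1) ^ 2 := by
          have : ‖Y.1 - X₀.1‖ ^ 2 / X₀.2 ^ 2 + (Y.2 / X₀.2 - 1) ^ 2 = sqn (X₀ - Y) / X₀.2 ^ 2 := by
            unfold sqn
            rw [Prod.fst_sub, Prod.snd_sub, norm_sub_rev]
            field_simp
            ring
          rw [this, le_div_iff₀ (by positivity)]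
          linarith
        have hb := hbar (‖Y.1 - X₀.1‖ ^ 2 / X₀.2 ^ 2) (Y.2 / X₀.2) (by positivity) (by positivity)
          (by
            refine le_trans (le_of_eq ?_) hYΛ
            unfold well; ring) hdist
        have hp : 0 < sqn Y ^ (-k - 1) := Real.rpow_pos_of_pos hY0 _
        have : 2 * k - (n - 2 * σ) = -(2 * k) := by rw [hk]; ring
        rw [this]
        have h4 : 0 < η * (2 * k * (2 * k) * sqn Y ^ (-k - 1)) := by positivity
        have h5 := mul_nonneg hM0 (mul_nonneg (a := m * Real.exp
          (-m * well ((2 - 2 * σ) / n) X₀ Y) / X₀.2 ^ 2) (by positivity) (sub_nonneg.2 hb))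
        linarith
  have hΓX : 0 < sqn X ^ (-k) := Real.rpow_pos_of_pos hX0 _
  refine le_of_forall_pos_le_add fun η hη => ?_
  have := key (η / sqn X ^ (-k)) (by positivity)
  rwa [div_mul_cancel₀ _ hΓX.ne'] at this

lemma sqn_lt_one_of_well_le {ε Λ : ℝ} (hε : 0 < ε) (ht₀ : 0 < X₀.2)
    (hX₀ : sqn X₀ * (4 + 2 * Λ / ε + Λ) < 1) {Y : Pt n} (hY : well ε X₀ Y ≤ Λ) : sqn Y < 1 := by
  refine lt_of_le_of_lt ?_ hX₀
  have hΛ : 0 ≤ Λ := (well_nonneg hε.le X₀ Y).trans hY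
  unfold well at hY
  set p : ℝ := ‖Y.1 - X₀.1‖ ^ 2 / X₀.2 ^ 2 with hp
  set q : ℝ := (Y.2 / X₀.2) ^ 2 with hq
  have hY' : ε * p + (q - 1) ^ 2 ≤ Λ := by
    refine le_trans (le_of_eq ?_) hY
    rw [hp]; ring
  have hp0 : 0 ≤ p := by positivity
  have hple : p ≤ Λ / ε := by
    rw [le_div_iff₀' hε]
    linarith [sq_nonneg (q - 1)]
  have hqle : q ≤ 2 + Λ := by
    have : 0 ≤ ε * p := by positivity
    nlinarith [sq_nonneg (q - 1 - 1 / 2)]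
  have e1 : ‖Y.1 - X₀.1‖ ^ 2 = p * X₀.2 ^ 2 := by rw [hp]; field_simp
  have e2 : Y.2 ^ 2 = q * X₀.2 ^ 2 := by rw [hq]; field_simp
  have h1 : ‖Y.1‖ ^ 2 ≤ 2 * ‖X₀.1‖ ^ 2 + 2 * ‖Y.1 - X₀.1‖ ^ 2 := by
    have h := norm_add_le X₀.1 (Y.1 - X₀.1)
    rw [add_sub_cancel] at h
    nlinarith [sq_nonneg (‖X₀.1‖ - ‖Y.1 - X₀.1‖), norm_nonneg Y.1]
  have hΛε : 0 ≤ Λ / ε := by positivity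
  calc sqn Y = ‖Y.1‖ ^ 2 + q * X₀.2 ^ 2 := by rw [sqn, e2]
    _ ≤ 2 * ‖X₀.1‖ ^ 2 + 2 * (Λ / ε * X₀.2 ^ 2) + (2 + Λ) * X₀.2 ^ 2 := by
        rw [e1] at h1
        have h2 := mul_le_mul_of_nonneg_right hple (sq_nonneg X₀.2)
        have h3 := mul_le_mul_of_nonneg_right hqle (sq_nonneg X₀.2)
        linarith
    _ ≤ 2 * sqn X₀ + 2 * (Λ / ε * sqn X₀) + (2 + Λ) * sqn X₀ := by
        have h2 : ‖X₀.1‖ ^ 2 ≤ sqn X₀ := by unfold sqn; linarith [sq_nonneg X₀.2]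
        have h3 : X₀.2 ^ 2 ≤ sqn X₀ := by unfold sqn; linarith [sq_nonneg ‖X₀.1‖]
        gcongr
    _ = _ := by ring

lemma exists_unit_inner_nonneg (hn : n ≠ 0) (x : EuclideanSpace ℝ (Fin n)) :
    ∃ e : EuclideanSpace ℝ (Fin n), ‖e‖ = 1 ∧ 0 ≤ ⟪x, e⟫ := by
  have : NeZero n := ⟨hn⟩
  have h1 : ‖EuclideanSpace.single (0 : Fin n) (1 : ℝ)‖ = 1 := by simp
  rcases le_total 0 ⟪x, EuclideanSpace.single (0 : Fin n) (1 : ℝ)⟫ with h | h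
  · exact ⟨_, h1, h⟩
  · exact ⟨-EuclideanSpace.single (0 : Fin n) (1 : ℝ), by rwa [norm_neg], by
      rw [inner_neg_right]; linarith⟩

/-- Upper bound near the origin. -/
lemma upper_bound_near_zero (hσ : σ ∈ Set.Ioo (0 : ℝ) 1) (hn : 2 ≤ n) (hU : ExtSol n σ 2 U)
    {c₂ γ : ℝ} (hγ : 0 ≤ γ) (hc₂ : 0 < c₂)
    (hpos : ∀ x : EuclideanSpace ℝ (Fin n), x ≠ 0 → ‖x‖ < 1 → 0 < U (x, 0))
    (hbd : ∀ x : EuclideanSpace ℝ (Fin n), 0 < ‖x‖ → ‖x‖ < 1 → U (x, 0) ≤ c₂ * ‖x‖ ^ (-γ)) :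
    ∃ B > 0, ∃ C > 0, ∀ X : Pt n, 0 < X.2 → sqn X * B < 1 → U X ≤ C * enorm' X ^ (-γ) := by
  have hn' : (2 : ℝ) ≤ n := by exact_mod_cast hn
  set ε : ℝ := (2 - 2 * σ) / n with hε
  have hε0 : 0 < ε := div_pos (by linarith [hσ.2]) (by linarith)
  set Λ : ℝ := 1 + 2 * ε with hΛ
  have hΛ0 : 0 < Λ := by positivity
  obtain ⟨m, hm, hbar⟩ := exists_well_exponent hσ hε0 hΛ0
  set g : ℝ := Real.exp (-m * (1 + ε)) - Real.exp (-m * Λ) with hg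
  have hg0 : 0 < g := by
    rw [hg, sub_pos, Real.exp_lt_exp, hΛ]
    nlinarith
  have hCH := harnackConst_pos (n := n)
  refine ⟨4 + 2 * Λ / ε + Λ, by positivity, c₂ * harnackConst n / g, by positivity,
    fun X ht hX => ?_⟩
  have hX0 : 0 < sqn X := by unfold sqn; positivity
  have hX4 : 4 * sqn X < 1 := by
    have h1 : 0 ≤ sqn X * (2 * Λ / ε + Λ) := by positivity
    linarith
  obtain ⟨e, he, hxe⟩ := exists_unit_inner_nonneg (by omega) X.1
  set y := X.1 + X.2 • e with hy
  have hysq : ‖y‖ ^ 2 = sqn X + 2 * (X.2 * ⟪X.1, e⟫) := by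
    rw [hy, norm_add_sq_real, inner_smul_right, norm_smul, he, Real.norm_eq_abs, mul_one, sq_abs,
      sqn]
    ring
  have hin : X.2 * ⟪X.1, e⟫ ≤ X.2 * ‖X.1‖ := by
    have := real_inner_le_norm X.1 e
    rw [he, mul_one] at this
    gcongr
  have hyge : sqn X ≤ ‖y‖ ^ 2 := by
    have : 0 ≤ X.2 * ⟪X.1, e⟫ := by positivity
    linarith
  have hy1 : ‖y‖ < 1 := by
    refine (sq_lt_one_iff₀ (norm_nonneg _)).1 ?_
    have : 2 * (X.2 * ‖X.1‖) ≤ sqn X := by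
      unfold sqn
      linarith [sq_nonneg (X.2 - ‖X.1‖)]
    linarith
  have hXy : enorm' X ≤ ‖y‖ := enorm'_le_of_sqn_le (norm_nonneg y) hyge
  have hX0' : 0 < enorm' X := Real.sqrt_pos.2 hX0
  have hwell : well ε X (y, 0) = 1 + ε := by
    have : y - X.1 = X.2 • e := by rw [hy]; abel
    simp only [well, this, norm_smul, he, Real.norm_eq_abs, mul_one, sq_abs]
    field_simp
    ring
  have hmain := barrier_le hσ hn hU hpos hm hbar ht (by linarith)
    (fun Y hY => sqn_lt_one_of_well_le hε0 ht hX hY) (X := (y, 0)) le_rfl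
    (by simp only [sqn]; linarith [sq_nonneg (0 : ℝ)]) (by rw [← hε, hwell]; linarith)
  rw [← hε, hwell, ← hg] at hmain
  have h1 := (hmain.trans (hbd y (hX0'.trans_le hXy) hy1)).trans
    (mul_le_mul_of_nonneg_left (Real.rpow_le_rpow_of_nonpos hX0' hXy (by linarith)) hc₂.le)
  rw [div_mul_eq_mul_div, div_le_iff₀ hCH, ← le_div_iff₀ hg0] at h1
  calc U X ≤ _ := h1
    _ = _ := by ring

theorem upper_bound (hσ : σ ∈ Set.Ioo (0 : ℝ) 1) (hn : 2 ≤ n) (hU : ExtSol n σ 2 U)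
    {c₂ γ : ℝ} (hγ : 0 ≤ γ) (hc₂ : 0 < c₂)
    (hpos : ∀ x : EuclideanSpace ℝ (Fin n), x ≠ 0 → ‖x‖ < 1 → 0 < U (x, 0))
    (hbd : ∀ x : EuclideanSpace ℝ (Fin n), 0 < ‖x‖ → ‖x‖ < 1 → U (x, 0) ≤ c₂ * ‖x‖ ^ (-γ)) :
    ∃ C₂ : ℝ, 0 < C₂ ∧ ∀ X : Pt n, 0 ≤ X.2 → 0 < enorm' X → enorm' X ≤ 1 / 2 →
      U X ≤ C₂ * enorm' X ^ (-γ) := by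
  obtain ⟨B, hB, C, hC, hnear⟩ := upper_bound_near_zero hσ hn hU hγ hc₂ hpos hbd
  set K : Set (Pt n) := {X | 1 / B ≤ sqn X ∧ sqn X ≤ 1 ^ 2 ∧ 0 ≤ X.2} with hK
  have hKc : IsClosed K :=
    (isClosed_le continuous_const continuous_sqn).inter
      ((isClosed_le continuous_sqn continuous_const).inter
        (isClosed_le continuous_const continuous_snd))
  obtain ⟨D, hD⟩ := (isCompact_of_sqn_le hKc zero_le_one fun X hX =>
    hX.2.1).exists_bound_of_continuousOn (hU.continuousOn fun X hX =>
      ⟨(by positivity : 0 < 1 / B).trans_le hX.1, by linarith [hX.2.1], hX.2.2⟩)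
  refine ⟨max (max C c₂) D, by positivity, fun X ht hX0 hX => ?_⟩
  have hp : 0 < enorm' X ^ (-γ) := Real.rpow_pos_of_pos hX0 _
  rcases ht.eq_or_lt with h | h
  · have hX' : X = (X.1, 0) := Prod.ext rfl h.symm
    have hX'' : enorm' X = ‖X.1‖ := by rw [hX']; simp [enorm']
    have h1 := hbd X.1 (hX'' ▸ hX0) (by rw [← hX'']; linarith)
    rw [← hX', ← hX''] at h1
    refine h1.trans (mul_le_mul_of_nonneg_right ?_ hp.le)
    exact (le_max_right _ _).trans (le_max_left _ _)
  rcases lt_or_ge (sqn X * B) 1 with h1 | h1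
  · refine (hnear X h h1).trans (mul_le_mul_of_nonneg_right ?_ hp.le)
    exact (le_max_left _ _).trans (le_max_left _ _)
  · have h2 := hD X ⟨(div_le_iff₀ hB).2 h1, by rw [← sq_enorm']; gcongr; linarith, ht⟩
    have h3 : 1 ≤ enorm' X ^ (-γ) :=
      Real.one_le_rpow_of_pos_of_le_one_of_nonpos hX0 (by linarith) (by linarith)
    have h4 : 0 ≤ max (max C c₂) D := le_max_of_le_left (le_max_of_le_left hC.le)
    calc U X ≤ D := (le_abs_self _).trans h2
      _ ≤ max (max C c₂) D := le_max_right _ _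
      _ ≤ _ := le_mul_of_one_le_right h4 h3

end Upper

/-- If the trace `u` satisfies two-sided bounds
`c₁|x|^{-(n-2σ)/2} ≤ u(x) ≤ c₂|x|^{-(n-2σ)/2}` for `0 < |x| < 1`, then `U` satisfies
analogous two-sided bounds `C₁|X|^{-(n-2σ)/2} ≤ U(X) ≤ C₂|X|^{-(n-2σ)/2}` for
`0 < |X| ≤ 1/2`, `t ≥ 0`. -/
theorem stmt_1 (n : ℕ) (hn : 2 ≤ n) (σ : ℝ) (hσ : σ ∈ Set.Ioo (0 : ℝ) 1)
    (U : Pt n → ℝ) (hU : ExtSol n σ 2 U)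
    (c₁ c₂ : ℝ) (hc₁ : 0 < c₁) (hc₂ : 0 < c₂)
    (hbd : ∀ x : EuclideanSpace ℝ (Fin n), 0 < ‖x‖ → ‖x‖ < 1 →
      c₁ * ‖x‖ ^ (-(((n : ℝ) - 2 * σ) / 2)) ≤ U (x, 0) ∧
      U (x, 0) ≤ c₂ * ‖x‖ ^ (-(((n : ℝ) - 2 * σ) / 2))) :
    ∃ C₁ : ℝ, 0 < C₁ ∧ ∃ C₂ : ℝ, 0 < C₂ ∧
      ∀ X : Pt n, 0 ≤ X.2 → 0 < enorm' X → enorm' X ≤ 1 / 2 →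
        C₁ * enorm' X ^ (-(((n : ℝ) - 2 * σ) / 2)) ≤ U X ∧
        U X ≤ C₂ * enorm' X ^ (-(((n : ℝ) - 2 * σ) / 2)) := by
  obtain ⟨C₁, hC₁, h₁⟩ := lower_bound hσ hn hU hc₁ fun x h0 h1 => (hbd x h0 h1).1
  have hγ : 0 ≤ ((n : ℝ) - 2 * σ) / 2 := by
    have hn' : (2 : ℝ) ≤ n := by exact_mod_cast hn
    linarith [hσ.2]
  obtain ⟨C₂, hC₂, h₂⟩ := upper_bound hσ hn hU hγ hc₂
    (fun x hx h1 => (mul_pos hc₁ (Real.rpow_pos_of_pos (norm_pos_iff.2 hx) _)).trans_le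
      (hbd x (norm_pos_iff.2 hx) h1).1) fun x h0 h1 => (hbd x h0 h1).2
  exact ⟨C₁, hC₁, C₂, hC₂, fun X ht h0 h1 => ⟨h₁ X ht h0 h1, h₂ X ht h0 h1⟩⟩
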